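/- arXiv:0803.3520 — 8 statements merged into one kernel-verified Lean document; each statement's English description precedes it below -/
import Mathlib

section
/- For every integer d ≥ 1 there exists a finite abstract simplicial complex K that is d-collapsible but not (2d−2)-representable; that is, the minimal d' for which K is d'-collapsible equals d, while the minimal d' for which K is d'-representable equals 2d−1. -/
/-- A finite abstract simplicial complex: a finite family of finite sets
closed under taking subsets. -/
def IsComplex {V : Type*} [DecidableEq V] (K : Finset (Finset V)) : Prop :=
  ∀ σ ∈ K, ∀ τ ⊆ σ, τ ∈ K

/-- `σ` is a `d`-collapsible face of `K`: it is a face of dimension `≤ d - 1`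
(i.e. with at most `d` vertices) contained in a unique inclusion-maximal face of `K`. -/
def IsCollapsibleFace {V : Type*} [DecidableEq V] (K : Finset (Finset V)) (d : ℕ)
    (σ : Finset V) : Prop :=
  σ ∈ K ∧ σ.card ≤ d ∧
    ∃! τ, τ ∈ K ∧ σ ⊆ τ ∧ ∀ ρ ∈ K, τ ⊆ ρ → ρ = τ

/-- An elementary `d`-collapse: remove all faces `η` with `σ ⊆ η ⊆ τ`, where `σ` is a
`d`-collapsible face and `τ` is the unique maximal face containing it. -/
def ElemCollapse {V : Type*} [DecidableEq V] (d : ℕ) (K K' : Finset (Finset V)) : Prop :=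
  ∃ σ τ : Finset V, σ ∈ K ∧ σ.card ≤ d ∧
    (τ ∈ K ∧ σ ⊆ τ ∧ ∀ ρ ∈ K, τ ⊆ ρ → ρ = τ) ∧
    (∀ τ' ∈ K, σ ⊆ τ' → (∀ ρ ∈ K, τ' ⊆ ρ → ρ = τ') → τ' = τ) ∧
    K' = K.filter (fun η => ¬ (σ ⊆ η ∧ η ⊆ τ))

/-- `K` is `d`-collapsible: some sequence of elementary `d`-collapses reduces `K`
to the empty complex. -/
def Collapsible {V : Type*} [DecidableEq V] (d : ℕ) (K : Finset (Finset V)) : Prop :=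
  Relation.ReflTransGen (ElemCollapse d) K ∅

/-- `K` is `d`-representable: it is (isomorphic to) the nerve of a family of convex
sets in `ℝ^d` indexed by its vertices. -/
def Representable {V : Type*} [DecidableEq V] (d : ℕ) (K : Finset (Finset V)) : Prop :=
  ∃ C : V → Set (Fin d → ℝ), (∀ v, Convex ℝ (C v)) ∧
    ∀ σ : Finset V, σ ∈ K ↔ ∃ x, ∀ v ∈ σ, x ∈ C v

/-- A face and the unique maximal face above it bound every face containing the former. -/
theorem subset_of_unique_maximal {V : Type*} {K : Finset (Finset V)} {σ τ ρ : Finset V}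
    (huniq : ∀ τ' ∈ K, σ ⊆ τ' → (∀ ρ ∈ K, τ' ⊆ ρ → ρ = τ') → τ' = τ)
    (hρ : ρ ∈ K) (hσρ : σ ⊆ ρ) : ρ ⊆ τ := by
  obtain ⟨m, hρm, hm⟩ := K.exists_le_maximal hρ
  have := huniq m hm.prop (hσρ.trans hρm) fun x hx hmx => (hm.eq_of_le hx hmx).symm
  exact this ▸ hρm

/-- The nerve of the sets `S v ∩ Y`, `v ∈ A`. -/
def nerveOn {V X : Type*} [DecidableEq V] [DecidableEq X] (A : Finset V) (S : V → Finset X)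
    (Y : Finset X) : Finset (Finset V) :=
  A.powerset.filter fun G => ∃ p ∈ Y, ∀ v ∈ G, p ∈ S v

/-- The points of `Y` common to all the sets `S v`, `v ∈ σ`. -/
def commonPoints {V X : Type*} [DecidableEq V] [DecidableEq X] (S : V → Finset X)
    (Y : Finset X) (σ : Finset V) : Finset X :=
  Y.filter fun q => ∀ v ∈ σ, q ∈ S v

section Collapsing

variable {V X : Type*} [DecidableEq V] [DecidableEq X]

theorem mem_nerveOn {A : Finset V} {S : V → Finset X} {Y : Finset X} {G : Finset V} :
    G ∈ nerveOn A S Y ↔ G ⊆ A ∧ ∃ p ∈ Y, ∀ v ∈ G, p ∈ S v := by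
  simp [nerveOn]

theorem mem_commonPoints {S : V → Finset X} {Y : Finset X} {σ : Finset V} {q : X} :
    q ∈ commonPoints S Y σ ↔ q ∈ Y ∧ ∀ v ∈ σ, q ∈ S v := by
  simp [commonPoints]

theorem commonPoints_anti {S : V → Finset X} {Y : Finset X} {σ τ : Finset V} (h : σ ⊆ τ) :
    commonPoints S Y τ ⊆ commonPoints S Y σ := fun q hq => by
  rw [mem_commonPoints] at hq ⊢
  exact ⟨hq.1, fun v hv => hq.2 v (h hv)⟩

theorem isComplex_nerveOn (A : Finset V) (S : V → Finset X) (Y : Finset X) :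
    IsComplex (nerveOn A S Y) := by
  intro σ hσ τ hτ
  rw [mem_nerveOn] at hσ ⊢
  obtain ⟨h, p, hp, hpv⟩ := hσ
  exact ⟨hτ.trans h, p, hp, fun v hv => hpv v (hτ hv)⟩

/-- All faces above `σ` without common point in `Y` can be removed by elementary collapses. -/
theorem collapse_commonPoints_eq_empty {d : ℕ} {S : V → Finset X} {Y : Finset X} {p : X}
    (hp : p ∉ Y) (n : ℕ) : ∀ (σ A B : Finset V) (K : Finset (Finset V)), A.card = n →
    (∀ v ∈ B, commonPoints S Y σ ⊆ S v) → (∀ v ∈ A, (S v).card ≤ d ∧ p ∈ S v) →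
    (σ = ∅ ∨ σ.card + (commonPoints S Y σ).card ≤ d) →
    (∀ η, σ ⊆ η → commonPoints S Y η = ∅ → (η ∈ K ↔ η ⊆ σ ∪ A ∪ B)) →
    Relation.ReflTransGen (ElemCollapse d) K
      (K.filter fun η => ¬ (σ ⊆ η ∧ commonPoints S Y η = ∅)) := by
  induction n with
  | zero =>
    intro σ A B K hcard hB hA hσ hK
    by_cases hQ : commonPoints S Y σ = ∅
    · have hall : ∀ η, σ ⊆ η → commonPoints S Y η = ∅ := fun η h =>
        Finset.subset_empty.1 (hQ ▸ commonPoints_anti h)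
      refine Relation.ReflTransGen.single ⟨σ, σ ∪ A ∪ B, ?_, ?_, ⟨?_, ?_, ?_⟩, ?_, ?_⟩
      · exact (hK σ subset_rfl hQ).2 (by grind)
      · grind
      · exact (hK _ (by grind) (hall _ (by grind))).2 subset_rfl
      · grind
      · intro ρ hρ hle
        exact subset_antisymm ((hK ρ (by grind) (hall _ (by grind))).1 hρ) hle
      · intro τ hτ hle hmax
        exact (hmax _ ((hK _ (by grind) (hall _ (by grind))).2 subset_rfl)
          ((hK τ hle (hall _ hle)).1 hτ)).symm
      · refine Finset.filter_congr fun η hη => not_congr (and_congr_right fun h => ?_)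
        exact ⟨fun h' => (hK η h h').1 hη, fun _ => hall η h⟩
    · rw [Finset.filter_true_of_mem]
      rintro η hη ⟨hle, hη0⟩
      have hsub := (hK η hle hη0).1 hη
      rw [Finset.card_eq_zero.1 hcard] at hsub
      obtain ⟨q, hq⟩ := Finset.nonempty_iff_ne_empty.2 hQ
      have : q ∈ commonPoints S Y η := by
        refine mem_commonPoints.2 ⟨(mem_commonPoints.1 hq).1, fun v hv => ?_⟩
        rcases Finset.mem_union.1 (hsub hv) with h | h
        · exact (mem_commonPoints.1 hq).2 v (by simpa using h)
        · exact hB v h hq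
      simp [hη0] at this
  | succ n ih =>
    intro σ A B K hcard hB hA hσ hK
    obtain ⟨v, hv⟩ : A.Nonempty := Finset.card_pos.1 (by omega)
    have hcard' : (A.erase v).card = n := by rw [Finset.card_erase_of_mem hv]; omega
    have hA' : ∀ w ∈ A.erase v, (S w).card ≤ d ∧ p ∈ S w :=
      fun w hw => hA w (Finset.mem_of_mem_erase hw)
    by_cases hvQ : commonPoints S Y σ ⊆ S v
    · refine ih σ (A.erase v) (insert v B) K hcard' ?_ hA' hσ fun η h h0 => ?_
      · intro w hw
        rcases Finset.mem_insert.1 hw with rfl | hw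
        · exact hvQ
        · exact hB w hw
      · rw [hK η h h0, show σ ∪ A.erase v ∪ insert v B = σ ∪ A ∪ B by grind]
    · have hvσ : v ∉ σ := fun h => hvQ fun q hq => (mem_commonPoints.1 hq).2 v h
      have hvB : v ∉ B := fun h => hvQ (hB v h)
      have hanti : commonPoints S Y (insert v σ) ⊆ commonPoints S Y σ :=
        commonPoints_anti (Finset.subset_insert _ _)
      have hlt : (insert v σ).card + (commonPoints S Y (insert v σ)).card ≤ d := by
        rw [Finset.card_insert_of_notMem hvσ]
        rcases hσ with rfl | hσ
        · have : commonPoints S Y (insert v ∅) ⊆ (S v).erase p := by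
            intro q hq
            rw [mem_commonPoints] at hq
            exact Finset.mem_erase.2 ⟨fun h => hp (h ▸ hq.1), hq.2 v (by simp)⟩
          have h1 := Finset.card_le_card this
          rw [Finset.card_erase_of_mem (hA v hv).2] at h1
          have h2 := Finset.card_pos.2 ⟨p, (hA v hv).2⟩
          have h3 := (hA v hv).1
          simp only [Finset.card_empty]
          omega
        · have : (commonPoints S Y (insert v σ)).card < (commonPoints S Y σ).card := by
            refine Finset.card_lt_card ⟨hanti, fun h => hvQ fun q hq => ?_⟩
            exact (mem_commonPoints.1 (h hq)).2 v (by simp)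
          omega
      have h1 := ih (insert v σ) (A.erase v) B K hcard' (fun w hw => hanti.trans (hB w hw)) hA'
        (Or.inr hlt) fun η h h0 => by
          rw [hK η ((Finset.subset_insert _ _).trans h) h0,
            show insert v σ ∪ A.erase v ∪ B = σ ∪ A ∪ B by grind]
      have h2 := ih σ (A.erase v) B
        (K.filter fun η => ¬ (insert v σ ⊆ η ∧ commonPoints S Y η = ∅)) hcard' hB hA' hσ
        fun η h h0 => by
          rw [Finset.mem_filter, hK η h h0]
          constructor
          · rintro ⟨h3, h4⟩
            have : v ∉ η := fun hvη => h4 ⟨Finset.insert_subset hvη h, h0⟩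
            grind
          · intro h3
            have : v ∉ η := by grind
            refine ⟨by grind, fun h4 => this (h4.1 (by simp))⟩
      have h3 : ((K.filter fun η => ¬ (insert v σ ⊆ η ∧ commonPoints S Y η = ∅)).filter
          fun η => ¬ (σ ⊆ η ∧ commonPoints S Y η = ∅)) =
          K.filter fun η => ¬ (σ ⊆ η ∧ commonPoints S Y η = ∅) := by
        rw [Finset.filter_filter]
        refine Finset.filter_congr fun η _ => ⟨fun h => h.2, fun h => ⟨fun h' => h ?_, h⟩⟩
        exact ⟨(Finset.subset_insert _ _).trans h'.1, h'.2⟩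
      exact h3 ▸ h1.trans h2

/-- The nerve of a finite family of sets of size at most `d` is `d`-collapsible. -/
theorem collapsible_nerveOn {d : ℕ} {A : Finset V} {S : V → Finset X}
    (hA : ∀ v ∈ A, (S v).card ≤ d) (Y : Finset X) : Collapsible d (nerveOn A S Y) := by
  induction Y using Finset.induction_on with
  | empty =>
    have : nerveOn A S ∅ = ∅ := by simp [nerveOn]
    rw [this]
    exact Relation.ReflTransGen.refl
  | insert p Y hp ih =>
    have h := collapse_commonPoints_eq_empty (d := d) (S := S) hp _ ∅
      (A.filter fun v => p ∈ S v) ∅ (nerveOn A S (insert p Y)) rfl (by simp)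
      (fun v hv => ⟨hA v (Finset.mem_filter.1 hv).1, (Finset.mem_filter.1 hv).2⟩) (Or.inl rfl)
      fun η _ h0 => by
        rw [mem_nerveOn]
        constructor
        · rintro ⟨h1, q, hq, hqv⟩ v hv
          rcases Finset.mem_insert.1 hq with rfl | hq
          · simpa using ⟨h1 hv, hqv v hv⟩
          · have : q ∈ commonPoints S Y η := mem_commonPoints.2 ⟨hq, hqv⟩
            simp [h0] at this
        · intro h1
          have h2 : ∀ v ∈ η, v ∈ A ∧ p ∈ S v := fun v hv => by simpa using h1 hv
          exact ⟨fun v hv => (h2 v hv).1, p, by simp, fun v hv => (h2 v hv).2⟩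
    have h' : ((nerveOn A S (insert p Y)).filter
        fun η => ¬ (∅ ⊆ η ∧ commonPoints S Y η = ∅)) = nerveOn A S Y := by
      ext η
      simp only [Finset.mem_filter, mem_nerveOn, Finset.empty_subset, true_and]
      constructor
      · rintro ⟨⟨h1, -⟩, h2⟩
        obtain ⟨q, hq⟩ := Finset.nonempty_iff_ne_empty.2 h2
        exact ⟨h1, q, mem_commonPoints.1 hq⟩
      · rintro ⟨h1, q, hq, hqv⟩
        refine ⟨⟨h1, q, by simp [hq], hqv⟩, fun h0 => ?_⟩
        have : q ∈ commonPoints S Y η := mem_commonPoints.2 ⟨hq, hqv⟩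
        simp [h0] at this
    exact (h' ▸ h).trans ih

/-- A complex containing the boundary of a simplex with more than `d + 1` vertices as an induced
subcomplex is not `d`-collapsible. -/
theorem not_collapsible_of_boundary {d : ℕ} {K : Finset (Finset V)} {W : Finset V}
    (hW : d + 1 < W.card) (hsub : ∀ η ⊂ W, η ∈ K) (hnot : ∀ ρ ∈ K, ¬ W ⊆ ρ) :
    ¬ Collapsible d K := by
  intro hK
  have key : ∀ K', Relation.ReflTransGen (ElemCollapse d) K K' →
      (∀ η ⊂ W, η ∈ K') ∧ ∀ ρ ∈ K', ¬ W ⊆ ρ := by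
    intro K' h
    induction h with
    | refl => exact ⟨hsub, hnot⟩
    | @tail L L' _ hstep ih =>
      obtain ⟨σ, τ, -, hσd, ⟨hτ, -, -⟩, huniq, rfl⟩ := hstep
      refine ⟨fun η hη => Finset.mem_filter.2 ⟨ih.1 η hη, ?_⟩,
        fun ρ hρ => ih.2 ρ (Finset.mem_filter.1 hρ).1⟩
      rintro ⟨hση, -⟩
      have hσW : σ ⊆ W := hση.trans hη.1
      have hdiff : 1 < (W \ σ).card := by
        rw [Finset.card_sdiff_of_subset hσW]; omega
      obtain ⟨a, ha, b, hb, hab⟩ := Finset.one_lt_card.1 hdiff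
      have herase : ∀ c ∈ W \ σ, W.erase c ⊆ τ := fun c hc => by
        refine subset_of_unique_maximal huniq
          (ih.1 _ (Finset.erase_ssubset (Finset.mem_sdiff.1 hc).1)) ?_
        exact Finset.subset_erase.2 ⟨hσW, (Finset.mem_sdiff.1 hc).2⟩
      refine ih.2 τ hτ fun w hw => ?_
      by_cases hwa : w = a
      · exact herase b hb (Finset.mem_erase.2 ⟨hwa ▸ hab, hw⟩)
      · exact herase a ha (Finset.mem_erase.2 ⟨hwa, hw⟩)
  have := (key ∅ hK).1 ∅ (Finset.empty_ssubset.2 (Finset.card_pos.1 (by omega)))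
  simp at this

end Collapsing

/-- A space of vectors of dimension at least two contains a nonzero vector with at most `d`
positive and at most `d` negative coordinates among `2 * d + 1`. -/
theorem exists_balanced_vector {ι : Type*} [Fintype ι] {d : ℕ} (hι : Fintype.card ι ≤ 2 * d + 1)
    (W : Submodule ℝ (ι → ℝ)) (hW : 1 < Module.finrank ℝ W) :
    ∃ c ∈ W, c ≠ 0 ∧ (Finset.univ.filter fun i => 0 < c i).card ≤ d ∧
      (Finset.univ.filter fun i => c i < 0).card ≤ d := by
  classical
  by_contra! hcon
  have hopen : ∀ f : W → ι → ℝ, Continuous f →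
      IsOpen {c : W | d < (Finset.univ.filter fun i => 0 < f c i).card} := by
    intro f hf
    have : {c : W | d < (Finset.univ.filter fun i => 0 < f c i).card} =
        ⋃ I : {I : Finset ι // d < I.card}, ⋂ i ∈ I.1, {c : W | 0 < f c i} := by
      ext c
      simp only [Set.mem_ofPred_eq, Set.mem_iUnion, Set.mem_iInter]
      constructor
      · intro h
        exact ⟨⟨_, h⟩, fun i hi => (Finset.mem_filter.1 hi).2⟩
      · rintro ⟨I, hI⟩
        exact I.2.trans_le (Finset.card_le_card fun i hi => by simpa using hI i hi)
    rw [this]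
    refine isOpen_iUnion fun I => isOpen_biInter_finset fun i _ => ?_
    exact isOpen_lt continuous_const ((continuous_apply i).comp hf)
  set P : Set W := {c | d < (Finset.univ.filter fun i => 0 < (c : ι → ℝ) i).card} with hP
  set N : Set W := {c | d < (Finset.univ.filter fun i => 0 < (-c : ι → ℝ) i).card} with hN
  have hPo : IsOpen P := hopen _ continuous_subtype_val
  have hNo : IsOpen N := hopen _ continuous_subtype_val.neg
  have hneg : ∀ c : W, -c ∈ P ↔ c ∈ N := fun c => by simp [hP, hN]
  have hneg' : ∀ c : W, -c ∈ N ↔ c ∈ P := fun c => by simp [hP, hN]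
  have hconn : IsConnected ({0}ᶜ : Set W) :=
    isConnected_compl_singleton_of_one_lt_rank
      (by rw [← Module.finrank_eq_rank]; exact_mod_cast hW) 0
  have hcover : ({0}ᶜ : Set W) ⊆ P ∪ N := by
    intro c hc
    by_cases h : c ∈ P
    · exact Or.inl h
    · refine Or.inr ?_
      have := hcon c c.2 (by simpa using hc) (not_lt.1 h)
      simpa [hN] using this
  obtain ⟨c, hc⟩ := hconn.nonempty
  have hc' : -c ∈ ({0}ᶜ : Set W) := by simpa using hc
  have hne : (({0}ᶜ : Set W) ∩ P).Nonempty ∧ (({0}ᶜ : Set W) ∩ N).Nonempty := by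
    rcases hcover hc with h | h
    · exact ⟨⟨c, hc, h⟩, ⟨-c, hc', (hneg' c).2 h⟩⟩
    · exact ⟨⟨-c, hc', (hneg c).2 h⟩, ⟨c, hc, h⟩⟩
  obtain ⟨x, -, hxP, hxN⟩ := hconn.isPreconnected P N hPo hNo hcover hne.1 hne.2
  have hdisj : Disjoint (Finset.univ.filter fun i => 0 < (x : ι → ℝ) i)
      (Finset.univ.filter fun i => 0 < (-x : ι → ℝ) i) := by
    rw [Finset.disjoint_filter]
    intro i _ h1 h2
    simp only [Pi.neg_apply] at h2
    linarith
  have h1 := Finset.card_union_of_disjoint hdisj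
  have h2 := Finset.card_le_univ ((Finset.univ.filter fun i => 0 < (x : ι → ℝ) i) ∪
      (Finset.univ.filter fun i => 0 < (-x : ι → ℝ) i))
  simp only [hP, hN, Set.mem_ofPred_eq] at hxP hxN
  omega

/-- The linear van Kampen–Flores theorem: among `2 * d + 1` points in a space of dimension at most
`2 * d - 2` there are two disjoint sets of at most `d` points with intersecting convex hulls. -/
theorem exists_disjoint_convexHull_inter {m d : ℕ} (hm : m + 2 ≤ 2 * d)
    (x : ℕ → Fin m → ℝ) : ∃ I J : Finset ℕ, I ⊆ Finset.range (2 * d + 1) ∧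
      J ⊆ Finset.range (2 * d + 1) ∧ I.card ≤ d ∧ J.card ≤ d ∧ Disjoint I J ∧
      (convexHull ℝ (x '' I) ∩ convexHull ℝ (x '' J)).Nonempty := by
  classical
  let n := 2 * d + 1
  let T : (Fin n → ℝ) →ₗ[ℝ] ℝ × (Fin m → ℝ) :=
    (Fintype.linearCombination ℝ (fun _ : Fin n => (1 : ℝ))).prod
      (Fintype.linearCombination ℝ (fun i : Fin n => x i))
  have hker : 1 < Module.finrank ℝ (LinearMap.ker T) := by
    have h1 := T.finrank_range_add_finrank_ker
    have h2 := Submodule.finrank_le (LinearMap.range T)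
    simp only [Module.finrank_prod, Module.finrank_self, Module.finrank_fintype_fun_eq_card,
      Fintype.card_fin] at h1 h2
    omega
  obtain ⟨c, hcT, hc0, hpos, hneg⟩ := exists_balanced_vector (d := d) (by simp [n]) _ hker
  have hsum : ∑ i, c i = 0 := by
    have := congrArg Prod.fst (LinearMap.mem_ker.1 hcT)
    simpa [T, Fintype.linearCombination_apply] using this
  have hvec : ∑ i, c i • x i = 0 := by
    have := congrArg Prod.snd (LinearMap.mem_ker.1 hcT)
    simpa [T, Fintype.linearCombination_apply] using this
  set P := Finset.univ.filter fun i => 0 < c i with hP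
  set N := Finset.univ.filter fun i => c i < 0 with hN
  have hsplit : ∀ {M : Type} [AddCommGroup M] (g : Fin n → M), (∀ i, c i = 0 → g i = 0) →
      ∑ i, g i = ∑ i ∈ P, g i + ∑ i ∈ N, g i := by
    intro M _ g hg
    have hPN : Disjoint P N := by
      rw [hP, hN, Finset.disjoint_filter]; intro i _ h1 h2; linarith
    rw [← Finset.sum_union hPN]
    refine (Finset.sum_subset (Finset.subset_univ _) fun i _ hi => hg i ?_).symm
    simp only [hP, hN, Finset.mem_union, Finset.mem_filter, Finset.mem_univ, true_and,
      not_or, not_lt] at hi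
    exact le_antisymm hi.1 hi.2
  have hs : ∑ i ∈ P, c i = ∑ i ∈ N, -c i := by
    rw [Finset.sum_neg_distrib, eq_neg_iff_add_eq_zero, ← hsplit c fun _ h => h, hsum]
  have hv : ∑ i ∈ P, c i • x i = ∑ i ∈ N, -c i • x i := by
    simp only [neg_smul]
    rw [Finset.sum_neg_distrib, eq_neg_iff_add_eq_zero,
      ← hsplit (fun i => c i • x i) fun i h => by simp [h], hvec]
  have hspos : 0 < ∑ i ∈ P, c i := by
    obtain ⟨i, hi⟩ := Function.ne_iff.1 hc0
    rcases lt_or_gt_of_ne hi with hi | hi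
    · rw [hs]
      exact Finset.sum_pos (fun j hj => neg_pos.2 (Finset.mem_filter.1 hj).2)
        ⟨i, by simpa [hN] using hi⟩
    · exact Finset.sum_pos (fun j hj => (Finset.mem_filter.1 hj).2)
        ⟨i, by simpa [hP] using hi⟩
  refine ⟨P.map Fin.valEmbedding, N.map Fin.valEmbedding, ?_, ?_, by simpa using hpos,
    by simpa using hneg, ?_, P.centerMass c fun i => x i, ?_, ?_⟩
  · intro i hi
    obtain ⟨j, -, rfl⟩ := Finset.mem_map.1 hi
    exact Finset.mem_range.2 j.2
  · intro i hi
    obtain ⟨j, -, rfl⟩ := Finset.mem_map.1 hi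
    exact Finset.mem_range.2 j.2
  · rw [Finset.disjoint_map, hP, hN, Finset.disjoint_filter]
    intro i _ h1 h2
    linarith
  · refine Finset.centerMass_mem_convexHull _ (fun i hi => (Finset.mem_filter.1 hi).2.le) hspos
      fun i hi => ⟨i, Finset.mem_map_of_mem _ hi, rfl⟩
  · have : P.centerMass c (fun i => x i) = N.centerMass (fun i => -c i) fun i => x i := by
      rw [Finset.centerMass, Finset.centerMass, hs, hv]
    rw [this]
    refine Finset.centerMass_mem_convexHull _
      (fun i hi => neg_nonneg.2 (Finset.mem_filter.1 hi).2.le) (hs ▸ hspos)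
      fun i hi => ⟨i, Finset.mem_map_of_mem _ hi, rfl⟩

/-- The point with parameter `t` on the moment curve in dimension `m`. -/
def momentPoint (m : ℕ) (t : ℕ) : Fin m → ℝ := fun j => (t : ℝ) ^ (j.val + 1)

/-- At most `m + 1` points on the moment curve in dimension `m` are affinely independent. -/
theorem eq_zero_of_sum_momentPoint_eq_zero {m : ℕ} {U : Finset ℕ} (hU : U.card ≤ m + 1)
    {c : ℕ → ℝ} (hc : ∑ i ∈ U, c i = 0) (hcx : ∑ i ∈ U, c i • momentPoint m i = 0) :
    ∀ i ∈ U, c i = 0 := by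
  intro i hi
  have hpow : ∀ k ≤ m, ∑ i ∈ U, c i * (i : ℝ) ^ k = 0 := by
    intro k hk
    rcases k with _ | k
    · simpa using hc
    · have := congrFun hcx ⟨k, hk⟩
      simpa [momentPoint] using this
  have hpoly : ∀ q : Polynomial ℝ, q.natDegree ≤ m → ∑ i ∈ U, c i * q.eval (i : ℝ) = 0 := by
    intro q hq
    simp only [Polynomial.eval_eq_sum_range, Finset.mul_sum]
    rw [Finset.sum_comm]
    refine Finset.sum_eq_zero fun k hk => ?_
    have : ∑ i ∈ U, c i * (q.coeff k * (i : ℝ) ^ k) =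
        q.coeff k * ∑ i ∈ U, c i * (i : ℝ) ^ k := by
      rw [Finset.mul_sum]
      exact Finset.sum_congr rfl fun i _ => by ring
    rw [this, hpow k (by rw [Finset.mem_range] at hk; omega), mul_zero]
  have h := hpoly (∏ j ∈ U.erase i, (Polynomial.X - Polynomial.C (j : ℝ))) (by
    rw [Polynomial.natDegree_finsetProd_X_sub_C_eq_card, Finset.card_erase_of_mem hi]
    omega)
  rw [Finset.sum_eq_single_of_mem i hi] at h
  · refine (mul_eq_zero.1 h).resolve_right ?_
    rw [Polynomial.eval_prod]
    refine Finset.prod_ne_zero_iff.2 ?_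
    intro j hj
    simpa [sub_eq_zero] using fun h => (Finset.ne_of_mem_erase hj) h.symm
  · intro j hj hji
    rw [Polynomial.eval_prod, Finset.prod_eq_zero (Finset.mem_erase.2 ⟨hji, hj⟩) (by simp),
      mul_zero]

/-- A nonempty family of sets of at most `d` points of the moment curve in dimension at least
`2 * d - 1` whose convex hulls share a point has a common element. -/
theorem exists_common_of_mem_convexHull_momentPoint {V : Type*} {m d : ℕ} (hm : 2 * d ≤ m + 1)
    {S : V → Finset ℕ} {G : Set V} (hG : G.Nonempty) (hS : ∀ v ∈ G, (S v).card ≤ d)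
    {x : Fin m → ℝ} (hx : ∀ v ∈ G, x ∈ convexHull ℝ (momentPoint m '' (S v : Set ℕ))) :
    ∃ p, ∀ v ∈ G, p ∈ S v := by
  classical
  have hrep : ∀ v ∈ G, ∃ w : ℕ → ℝ, (∀ i ∉ S v, w i = 0) ∧ ∑ i ∈ S v, w i = 1 ∧
      ∑ i ∈ S v, w i • momentPoint m i = x := by
    intro v hv
    have hmem := hx v hv
    have hinj : Set.InjOn (momentPoint m) (S v) := by
      intro i hi j hj hij
      rcases m with _ | m
      · exact Finset.card_le_one.1 (by have := hS v hv; omega) i hi j hj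
      · simpa [momentPoint] using congrFun hij 0
    rw [← Finset.coe_image, Finset.mem_convexHull'] at hmem
    obtain ⟨w, -, hw1, hwx⟩ := hmem
    rw [Finset.sum_image hinj] at hw1 hwx
    refine ⟨fun i => if i ∈ S v then w (momentPoint m i) else 0, fun i hi => if_neg hi, ?_, ?_⟩
    · rw [← hw1]
      exact Finset.sum_congr rfl fun i hi => if_pos hi
    · rw [← hwx]
      exact Finset.sum_congr rfl fun i hi => by simp only [if_pos hi]
  obtain ⟨v, hv⟩ := hG
  obtain ⟨w, hw0, hw1, hwx⟩ := hrep v hv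
  obtain ⟨p, hp, hpw⟩ := Finset.exists_ne_zero_of_sum_ne_zero (hw1 ▸ one_ne_zero)
  refine ⟨p, fun u hu => ?_⟩
  obtain ⟨w', hw0', hw1', hwx'⟩ := hrep u hu
  by_contra hpu
  have hext : ∀ {M : Type} [AddCommGroup M] (s : Finset ℕ) (g : ℕ → M), s ⊆ S v ∪ S u →
      (∀ i ∉ s, g i = 0) → ∑ i ∈ S v ∪ S u, g i = ∑ i ∈ s, g i := fun s g hs hg =>
    (Finset.sum_subset hs fun i _ hi => hg i hi).symm
  have h := eq_zero_of_sum_momentPoint_eq_zero (m := m) (U := S v ∪ S u)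
    (c := fun i => w i - w' i)
    ((Finset.card_union_le _ _).trans (by have := hS v hv; have := hS u hu; omega))
    (by
      rw [Finset.sum_sub_distrib, hext (S v) w Finset.subset_union_left hw0,
        hext (S u) w' Finset.subset_union_right hw0', hw1, hw1', sub_self])
    (by
      simp only [sub_smul]
      rw [Finset.sum_sub_distrib,
        hext (S v) (fun i => w i • momentPoint m i) Finset.subset_union_left
          fun i hi => by simp [hw0 i hi],
        hext (S u) (fun i => w' i • momentPoint m i) Finset.subset_union_right
          fun i hi => by simp [hw0' i hi], hwx, hwx', sub_self])
    p (Finset.mem_union_left _ hp)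
  simp only [hw0' p hpu, sub_zero] at h
  exact hpw h

/-- For every `d ≥ 1` there is a finite simplicial complex `K` whose collapsibility
number (least `d'` such that `K` is `d'`-collapsible) equals `d` and whose
representability number (least `d'` such that `K` is `d'`-representable) equals `2d - 1`. -/
theorem collapsible_not_representable_gap (d : ℕ) (hd : 1 ≤ d) :
    ∃ K : Finset (Finset ℕ), IsComplex K ∧
      IsLeast {d' : ℕ | Collapsible d' K} d ∧
      IsLeast {d' : ℕ | Representable d' K} (2 * d - 1) := by
  classical
  let S : ℕ ≃ Finset ℕ := Finset.equivBitIndices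
  let Y := Finset.range (2 * d + 1)
  let A : Finset ℕ := (Y.powerset.filter fun s => s.card ≤ d).map S.symm.toEmbedding
  have hA : ∀ v, v ∈ A ↔ S v ⊆ Y ∧ (S v).card ≤ d := by
    intro v
    simp only [A, Finset.mem_map_equiv, Finset.mem_filter, Finset.mem_powerset,
      Equiv.symm_symm]
  refine ⟨nerveOn A S Y, isComplex_nerveOn A S Y,
    ⟨collapsible_nerveOn (fun v hv => ((hA v).1 hv).2) Y, ?_⟩, ⟨?_, ?_⟩⟩
  · intro d' hd'
    by_contra! hlt
    let W : Finset ℕ := ((Finset.range (d + 1)).powersetCard d).map S.symm.toEmbedding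
    have hW : ∀ v, v ∈ W ↔ S v ⊆ Finset.range (d + 1) ∧ (S v).card = d := by
      intro v
      simp only [W, Finset.mem_map_equiv, Finset.mem_powersetCard, Equiv.symm_symm]
    refine not_collapsible_of_boundary (W := W) ?_ ?_ ?_ hd'
    · simp only [W, Finset.card_map, Finset.card_powersetCard, Finset.card_range,
        Nat.choose_succ_self_right]
      omega
    · intro η hη
      obtain ⟨w, hw, hwη⟩ := Finset.exists_of_ssubset hη
      rw [hW] at hw
      obtain ⟨p, hp⟩ : (Finset.range (d + 1) \ S w).Nonempty := by
        rw [← Finset.card_pos, Finset.card_sdiff_of_subset hw.1, Finset.card_range]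
        omega
      rw [Finset.mem_sdiff] at hp
      refine mem_nerveOn.2 ⟨fun v hv => (hA v).2 ?_, p, ?_, fun v hv => ?_⟩
      · have := (hW v).1 (hη.1 hv)
        exact ⟨this.1.trans (Finset.range_subset_range.2 (by omega)), this.2.le⟩
      · have := Finset.mem_range.1 hp.1
        exact Finset.mem_range.2 (by omega)
      · by_contra hpv
        have h1 := (hW v).1 (hη.1 hv)
        have heq : ∀ s ⊆ Finset.range (d + 1), s.card = d → p ∉ s →
            s = (Finset.range (d + 1)).erase p := fun s hs hsd hps =>
          Finset.eq_of_subset_of_card_le (Finset.subset_erase.2 ⟨hs, hps⟩) (by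
            rw [Finset.card_erase_of_mem hp.1, Finset.card_range]; omega)
        have h2 : S v = S w := (heq _ h1.1 h1.2 hpv).trans (heq _ hw.1 hw.2 hp.2).symm
        exact hwη (S.injective h2 ▸ hv)
    · intro ρ hρ hWρ
      obtain ⟨-, p, -, hp⟩ := mem_nerveOn.1 hρ
      have hmem : ∀ s ⊆ Finset.range (d + 1), s.card = d → p ∈ s := fun s hs hsd => by
        have := hp (S.symm s) (hWρ ((hW _).2 (by simpa using ⟨hs, hsd⟩)))
        simpa using this
      have hpd := hmem (Finset.range d) (Finset.range_subset_range.2 (by omega)) (by simp)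
      have := hmem ((Finset.range (d + 1)).erase p) (Finset.erase_subset _ _) (by
        rw [Finset.card_erase_of_mem, Finset.card_range]
        · omega
        · exact Finset.range_subset_range.2 (by omega) hpd)
      simp at this
  · refine ⟨fun v => if v ∈ A then convexHull ℝ (momentPoint _ '' (S v : Set ℕ)) else ∅,
      fun v => ?_, fun σ => ?_⟩
    · dsimp only
      split_ifs
      · exact convex_convexHull ℝ _
      · exact convex_empty
    · rw [mem_nerveOn]
      constructor
      · rintro ⟨hσ, p, -, hp⟩
        refine ⟨momentPoint _ p, fun v hv => ?_⟩
        simp only [if_pos (hσ hv)]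
        exact subset_convexHull ℝ _ ⟨p, hp v hv, rfl⟩
      · rintro ⟨x, hx⟩
        have hσA : σ ⊆ A := fun v hv => by
          by_contra hvA
          have := hx v hv
          simp only [if_neg hvA] at this
          exact this
        refine ⟨hσA, ?_⟩
        rcases σ.eq_empty_or_nonempty with rfl | hne
        · exact ⟨0, by simp [Y], by simp⟩
        · obtain ⟨p, hp⟩ := exists_common_of_mem_convexHull_momentPoint (d := d)
            (m := 2 * d - 1) (S := S) (G := (σ : Set ℕ)) (x := x) (by omega) hne
            (fun v hv => ((hA v).1 (hσA hv)).2)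
            (fun v hv => by simpa only [if_pos (hσA hv)] using hx v hv)
          obtain ⟨v, hv⟩ := hne
          exact ⟨p, ((hA v).1 (hσA hv)).1 (hp v hv), hp⟩
  · rintro m ⟨C, hconv, hC⟩
    by_contra! hlt
    have hstar : ∀ p, ∃ x, p ∈ Y → ∀ v ∈ A, p ∈ S v → x ∈ C v := by
      intro p
      by_cases hp : p ∈ Y
      · obtain ⟨x, hx⟩ := (hC (A.filter fun v => p ∈ S v)).1
          (mem_nerveOn.2 ⟨Finset.filter_subset _ _, p, hp, fun v hv => (Finset.mem_filter.1 hv).2⟩)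
        exact ⟨x, fun _ v hv hpv => hx v (Finset.mem_filter.2 ⟨hv, hpv⟩)⟩
      · exact ⟨0, fun h => absurd h hp⟩
    choose x hx using hstar
    obtain ⟨I, J, hI, hJ, hId, hJd, hdisj, z, hzI, hzJ⟩ :=
      exists_disjoint_convexHull_inter (d := d) (by omega) x
    have hhull : ∀ T : Finset ℕ, T ⊆ Y → T.card ≤ d →
        convexHull ℝ (x '' T) ⊆ C (S.symm T) := by
      intro T hT hTd
      refine convexHull_min ?_ (hconv _)
      rintro _ ⟨p, hp, rfl⟩
      exact hx p (hT hp) _ ((hA _).2 (by simpa using ⟨hT, hTd⟩)) (by simpa using hp)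
    have hface : ({S.symm I, S.symm J} : Finset ℕ) ∈ nerveOn A S Y := by
      refine (hC _).2 ⟨z, fun v hv => ?_⟩
      rcases Finset.mem_insert.1 hv with rfl | hv
      · exact hhull I hI hId hzI
      · rw [Finset.mem_singleton.1 hv]
        exact hhull J hJ hJd hzJ
    obtain ⟨-, p, -, hp⟩ := mem_nerveOn.1 hface
    exact Finset.disjoint_left.1 hdisj (by simpa using hp (S.symm I) (by simp))
      (by simpa using hp (S.symm J) (by simp))
end

section
/- For every integer d ≥ 1 there exists a finite abstract simplicial complex K that is 2d-Leray but not (3d−1)-collapsible; that is, the minimal d' for which K is d'-Leray equals 2d, while the minimal d' for which K is d'-collapsible equals 3d. -/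
/-- The simplicial boundary operator on formal ℚ-linear combinations of finite subsets
of a linearly ordered vertex set: a set of cardinality `k+1` represents a `k`-simplex
(with the empty set representing the augmentation `(-1)`-simplex), and
`∂σ = ∑_{v ∈ σ} (-1)^{(position of v in σ)} (σ \ {v})`. -/
noncomputable def bdry {V : Type*} [DecidableEq V] [LinearOrder V] :
    (Finset V →₀ ℚ) →ₗ[ℚ] (Finset V →₀ ℚ) :=
  Finsupp.lsum ℚ (fun σ => LinearMap.toSpanSingleton ℚ (Finset V →₀ ℚ)
    (∑ v ∈ σ, ((-1 : ℚ) ^ ((σ.filter (· < v)).card)) • Finsupp.single (σ.erase v) (1 : ℚ)))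

/-- `c` is a simplicial chain on `K` supported on faces with exactly `n` vertices. -/
def IsChainOn {V : Type*} [DecidableEq V] (K : Finset (Finset V)) (n : ℕ)
    (c : Finset V →₀ ℚ) : Prop :=
  ∀ σ ∈ c.support, σ ∈ K ∧ σ.card = n

/-- The reduced simplicial homology (over ℚ) of `K` vanishes in dimension `k`:
every `k`-dimensional cycle is the boundary of a `(k+1)`-dimensional chain. -/
def HomologyVanishes {V : Type*} [DecidableEq V] [LinearOrder V]
    (K : Finset (Finset V)) (k : ℕ) : Prop :=
  ∀ c : Finset V →₀ ℚ, IsChainOn K (k + 1) c → bdry c = 0 →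
    ∃ b : Finset V →₀ ℚ, IsChainOn K (k + 2) b ∧ bdry b = c

/-- The induced subcomplex `K[X] = {σ ∩ X : σ ∈ K}`. -/
def InducedSub {V : Type*} [DecidableEq V] (K : Finset (Finset V)) (X : Finset V) :
    Finset (Finset V) :=
  K.image (· ∩ X)

/-- `K` is `d`-Leray: every induced subcomplex has vanishing reduced rational homology
in every dimension `≥ d`. -/
def IsLeray {V : Type*} [DecidableEq V] [LinearOrder V] (d : ℕ)
    (K : Finset (Finset V)) : Prop :=
  ∀ X : Finset V, ∀ k : ℕ, d ≤ k → HomologyVanishes (InducedSub K X) k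

/-- The join of two simplicial complexes (on disjoint vertex sets). -/
def Join {V : Type*} [DecidableEq V] (K L : Finset (Finset V)) : Finset (Finset V) :=
  (K ×ˢ L).image (fun p => p.1 ∪ p.2)

/-- The vertex set of a complex. -/
def verts {V : Type*} [DecidableEq V] (K : Finset (Finset V)) : Finset V :=
  K.sup id

open Finset

/-- The sign with which `v` is removed from `insert v τ` in the simplicial boundary. -/
def faceSign (v : ℕ) (τ : Finset ℕ) : ℚ := (-1) ^ (τ.filter (· < v)).card

/-- The simplicial boundary of a chain supported on subsets of `S`, as a coefficient function. -/
def coeffBdry (S : Finset ℕ) (c : Finset ℕ → ℚ) (τ : Finset ℕ) : ℚ :=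
  ∑ v ∈ S \ τ, faceSign v τ * c (insert v τ)

/-- `c` is supported on the sets with `n` elements that satisfy `P`. -/
def IsCoeffChain (P : Finset ℕ → Prop) (n : ℕ) (c : Finset ℕ → ℚ) : Prop :=
  ∀ σ, c σ ≠ 0 → P σ ∧ σ.card = n

/-- Cycles with `n` vertices are boundaries, for chains viewed as coefficient functions. -/
def CoeffVanishes (S : Finset ℕ) (P : Finset ℕ → Prop) (n : ℕ) : Prop :=
  ∀ c, IsCoeffChain P n c → (∀ τ ⊆ S, coeffBdry S c τ = 0) →
    ∃ b, IsCoeffChain P (n + 1) b ∧ ∀ τ ⊆ S, coeffBdry S b τ = c τ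

theorem faceSign_mul_faceSign_insert {v w : ℕ} {τ : Finset ℕ} (hv : v ∉ τ) (hw : w ∉ τ)
    (hvw : v ≠ w) :
    faceSign v τ * faceSign w (insert v τ) = -(faceSign w τ * faceSign v (insert w τ)) := by
  unfold faceSign
  rw [filter_insert, filter_insert]
  rcases lt_or_gt_of_ne hvw with h | h
  · rw [if_pos h, if_neg h.not_gt, card_insert_of_notMem (by simp [hv])]
    ring
  · rw [if_neg h.not_gt, if_pos h, card_insert_of_notMem (by simp [hw])]
    ring

theorem coeffBdry_coeffBdry (S : Finset ℕ) (c : Finset ℕ → ℚ) (τ : Finset ℕ) :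
    coeffBdry S (coeffBdry S c) τ = 0 := by
  unfold coeffBdry
  simp_rw [mul_sum]
  rw [sum_sigma']
  refine sum_involution (fun p _ => ⟨p.2, p.1⟩) ?_ ?_ ?_ ?_
  · rintro ⟨v, w⟩ h
    simp only [mem_sigma, mem_sdiff, mem_insert, not_or] at h
    have := faceSign_mul_faceSign_insert h.1.2 h.2.2.2 (Ne.symm h.2.2.1)
    simp only [insert_comm w v, ← mul_assoc, this]
    ring
  · rintro ⟨v, w⟩ h _ heq
    simp only [mem_sigma, mem_sdiff, mem_insert, not_or] at h
    simp only [Sigma.mk.injEq] at heq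
    exact h.2.2.1 heq.1
  · rintro ⟨v, w⟩ h
    simp only [mem_sigma, mem_sdiff, mem_insert, not_or] at h ⊢
    exact ⟨⟨h.2.1, h.2.2.2⟩, h.1.1, Ne.symm h.2.2.1, h.1.2⟩
  · rintro ⟨v, w⟩ h
    rfl

theorem coeffBdry_sub (S : Finset ℕ) (b c : Finset ℕ → ℚ) (τ : Finset ℕ) :
    coeffBdry S (fun σ => b σ - c σ) τ = coeffBdry S b τ - coeffBdry S c τ := by
  simp [coeffBdry, mul_sub]

theorem coeffBdry_add (S : Finset ℕ) (b c : Finset ℕ → ℚ) (τ : Finset ℕ) :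
    coeffBdry S (fun σ => b σ + c σ) τ = coeffBdry S b τ + coeffBdry S c τ := by
  simp [coeffBdry, mul_add, sum_add_distrib]

theorem coeffBdry_mul_left (S : Finset ℕ) (r : ℚ) (c : Finset ℕ → ℚ) (τ : Finset ℕ) :
    coeffBdry S (fun σ => r * c σ) τ = r * coeffBdry S c τ := by
  simp only [coeffBdry, mul_sum]
  exact sum_congr rfl fun _ _ => by ring

theorem coeffBdry_congr {S : Finset ℕ} {b c : Finset ℕ → ℚ} (h : ∀ σ ⊆ S, b σ = c σ)
    {τ : Finset ℕ} (hτ : τ ⊆ S) : coeffBdry S b τ = coeffBdry S c τ :=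
  sum_congr rfl fun v hv => by
    rw [h _ (insert_subset (mem_sdiff.1 hv).1 hτ)]

/-- The boundary in a join: the first term is the boundary in the lower factor, the second one
is the boundary in the upper factor. -/
theorem coeffBdry_union {A T : Finset ℕ} (hAT : ∀ a ∈ A, ∀ t ∈ T, a < t) (c : Finset ℕ → ℚ)
    {τ ρ : Finset ℕ} (hτ : τ ⊆ A) (hρ : ρ ⊆ T) :
    coeffBdry (A ∪ T) c (τ ∪ ρ) = coeffBdry A (fun τ' => c (τ' ∪ ρ)) τ +
      (-1) ^ τ.card * ∑ v ∈ T \ ρ, faceSign v ρ * c (τ ∪ insert v ρ) := by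
  have hsplit : (A ∪ T) \ (τ ∪ ρ) = (A \ τ) ∪ (T \ ρ) := by
    ext v
    simp only [mem_sdiff, mem_union]
    constructor
    · tauto
    · rintro (⟨h1, h2⟩ | ⟨h1, h2⟩)
      · exact ⟨Or.inl h1, fun h => h.elim h2 fun h => (hAT v h1 v (hρ h)).false⟩
      · exact ⟨Or.inr h1, fun h => h.elim (fun h => (hAT v (hτ h) v h1).false) h2⟩
  have hdisj : Disjoint (A \ τ) (T \ ρ) := by
    rw [disjoint_left]
    intro v h1 h2
    exact (hAT v (mem_sdiff.1 h1).1 v (mem_sdiff.1 h2).1).false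
  unfold coeffBdry
  rw [hsplit, sum_union hdisj, mul_sum]
  congr 1
  · refine sum_congr rfl fun v hv => ?_
    have hvA := (mem_sdiff.1 hv).1
    have : ρ.filter (· < v) = ∅ :=
      filter_eq_empty_iff.2 fun w hw => (hAT v hvA w (hρ hw)).not_gt
    simp only [faceSign, filter_union, this, union_empty, insert_union]
  · refine sum_congr rfl fun v hv => ?_
    have hvT := (mem_sdiff.1 hv).1
    have h1 : τ.filter (· < v) = τ := filter_true_of_mem fun w hw => hAT w (hτ hw) v hvT
    have h2 : Disjoint τ (ρ.filter (· < v)) := by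
      rw [disjoint_left]
      intro w hw hw'
      exact (hAT w (hτ hw) w (hρ (mem_filter.1 hw').1)).false
    rw [faceSign, faceSign, filter_union, h1, card_union_of_disjoint h2, pow_add, union_insert]
    ring

/-- The join of the family `P` of subsets of `A` with the family `L` of subsets of `T`. -/
def JoinPred (A T : Finset ℕ) (P : Finset ℕ → Prop) (L : Finset (Finset ℕ))
    (σ : Finset ℕ) : Prop :=
  σ ⊆ A ∪ T ∧ P (σ ∩ A) ∧ σ ∩ T ∈ L

theorem inter_union_inter_of_subset {A T σ : Finset ℕ} (hσ : σ ⊆ A ∪ T) : (σ ∩ A) ∪ (σ ∩ T) = σ := by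
  rw [← inter_union_distrib_left, inter_eq_left.2 hσ]

theorem union_inter_lower {A T : Finset ℕ}
    (hAT : ∀ a ∈ A, ∀ t ∈ T, a < t) {τ ρ : Finset ℕ} (hτ : τ ⊆ A) (hρ : ρ ⊆ T) :
    (τ ∪ ρ) ∩ A = τ := by
  ext v
  simp only [mem_inter, mem_union]
  exact ⟨fun h => h.1.elim id fun h' => ((hAT v h.2 v (hρ h')).false).elim,
    fun h => ⟨Or.inl h, hτ h⟩⟩

theorem union_inter_upper {A T : Finset ℕ}
    (hAT : ∀ a ∈ A, ∀ t ∈ T, a < t) {τ ρ : Finset ℕ} (hτ : τ ⊆ A) (hρ : ρ ⊆ T) :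
    (τ ∪ ρ) ∩ T = ρ := by
  ext v
  simp only [mem_inter, mem_union]
  exact ⟨fun h => h.1.elim (fun h' => ((hAT v (hτ h') v h.2).false).elim) id,
    fun h => ⟨Or.inr h, hρ h⟩⟩

theorem card_union_of_lt {A T : Finset ℕ}
    (hAT : ∀ a ∈ A, ∀ t ∈ T, a < t) {τ ρ : Finset ℕ} (hτ : τ ⊆ A) (hρ : ρ ⊆ T) :
    (τ ∪ ρ).card = τ.card + ρ.card :=
  card_union_of_disjoint <| disjoint_left.2 fun v h1 h2 => (hAT v (hτ h1) v (hρ h2)).false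

/-- If the part of a cycle over a maximal face `ρ` of `L` is a boundary, the cycle can be pushed
off `ρ`. -/
theorem exists_push_off {A T : Finset ℕ} (hAT : ∀ a ∈ A, ∀ t ∈ T, a < t)
    {P : Finset ℕ → Prop} (hP : ∀ σ, P σ → ∀ τ ⊆ σ, P τ)
    {L : Finset (Finset ℕ)} (hLT : ∀ ρ ∈ L, ρ ⊆ T) (hL : IsComplex L)
    {n p : ℕ} {c : Finset ℕ → ℚ} (hc : IsCoeffChain (JoinPred A T P L) n c)
    (hc0 : ∀ τ ⊆ A ∪ T, coeffBdry (A ∪ T) c τ = 0) {ρ : Finset ℕ} (hρ : ρ ∈ L)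
    (hpn : p + ρ.card = n + 1) {g : Finset ℕ → ℚ} (hg : IsCoeffChain P p g)
    (hgc : ∀ τ ⊆ A, coeffBdry A g τ = c (τ ∪ ρ))
    (hvan : CoeffVanishes (A ∪ T) (JoinPred A T P (L.erase ρ)) n) :
    ∃ b, IsCoeffChain (JoinPred A T P L) (n + 1) b ∧
      ∀ τ ⊆ A ∪ T, coeffBdry (A ∪ T) b τ = c τ := by
  have hρT := hLT ρ hρ
  let G : Finset ℕ → ℚ := fun σ => if σ ⊆ A ∪ T ∧ σ ∩ T = ρ then g (σ ∩ A) else 0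
  have hG : IsCoeffChain (JoinPred A T P L) (n + 1) G := by
    intro σ hσ
    by_cases h : σ ⊆ A ∪ T ∧ σ ∩ T = ρ
    · simp only [G, if_pos h] at hσ
      obtain ⟨h1, h2⟩ := hg _ hσ
      refine ⟨⟨h.1, h1, h.2 ▸ hρ⟩, ?_⟩
      rw [← inter_union_inter_of_subset h.1, card_union_of_lt hAT inter_subset_right
        inter_subset_right, h2, h.2, hpn]
    · simp [G, if_neg h] at hσ
  let c' : Finset ℕ → ℚ := fun σ => if σ ⊆ A ∪ T then c σ - coeffBdry (A ∪ T) G σ else 0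
  have hc' : IsCoeffChain (JoinPred A T P (L.erase ρ)) n c' := by
    intro σ hσ
    by_cases hS : σ ⊆ A ∪ T
    swap
    · simp [c', hS] at hσ
    simp only [c', if_pos hS] at hσ
    have hJ : JoinPred A T P L σ ∧ σ.card = n := by
      by_cases h0 : c σ = 0
      · rw [h0, zero_sub, neg_ne_zero] at hσ
        obtain ⟨v, hv, hv0⟩ := exists_ne_zero_of_sum_ne_zero hσ
        obtain ⟨⟨_, h1, h2⟩, h3⟩ := hG _ (right_ne_zero_of_mul hv0)
        rw [card_insert_of_notMem (mem_sdiff.1 hv).2] at h3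
        exact ⟨⟨hS, hP _ h1 _ (inter_subset_inter_right (subset_insert _ _)),
          hL _ h2 _ (inter_subset_inter_right (subset_insert _ _))⟩, by omega⟩
      · exact hc σ h0
    refine ⟨⟨hS, hJ.1.2.1, mem_erase.2 ⟨fun hσρ => hσ ?_, hJ.1.2.2⟩⟩, hJ.2⟩
    have hA : σ ∩ A ⊆ A := inter_subset_right
    rw [← inter_union_inter_of_subset hS, hσρ, coeffBdry_union hAT G hA hρT, ← hgc _ hA, sum_eq_zero,
      coeffBdry_congr (b := fun τ' => G (τ' ∪ ρ)) (c := g) _ hA]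
    · ring
    · intro τ hτ
      simp only [G, union_inter_lower hAT hτ hρT, union_inter_upper hAT hτ hρT, and_true]
      rw [if_pos (union_subset_union hτ hρT)]
    · intro v hv
      obtain ⟨hvT, hvρ⟩ := mem_sdiff.1 hv
      simp only [G, union_inter_upper hAT hA (insert_subset hvT hρT)]
      rw [if_neg, mul_zero]
      exact fun h => hvρ (h.2 ▸ mem_insert_self _ _)
  obtain ⟨b, hb, hbc⟩ := hvan c' hc' fun τ hτ => by
    rw [coeffBdry_congr (c := fun σ => c σ - coeffBdry (A ∪ T) G σ) _ hτ, coeffBdry_sub, hc0 τ hτ,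
      coeffBdry_coeffBdry, sub_zero]
    intro σ hσ
    simp [c', hσ]
  refine ⟨fun σ => b σ + G σ, ?_, fun τ hτ => ?_⟩
  · intro σ hσ
    by_cases h0 : b σ = 0
    · exact hG σ (by simpa [h0] using hσ)
    · obtain ⟨⟨h1, h2, h3⟩, h4⟩ := hb σ h0
      exact ⟨⟨h1, h2, mem_of_mem_erase h3⟩, h4⟩
  · rw [coeffBdry_add, hbc τ hτ]
    simp [c', hτ]

/-- If the homology of `P` vanishes for faces with more than `m` vertices, and `L` has faces with
at most `3` vertices and no cycles with `3` vertices with any coefficients (hypothesis `htop`),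
then the homology of the join vanishes for faces with more than `m + 2` vertices. -/
theorem coeffVanishes_join {A T : Finset ℕ} (hAT : ∀ a ∈ A, ∀ t ∈ T, a < t)
    {P : Finset ℕ → Prop} (hP : ∀ σ, P σ → ∀ τ ⊆ σ, P τ) {m : ℕ}
    (hvan : ∀ n, m < n → CoeffVanishes A P n)
    (Q : Finset ℕ → Prop)
    (htop : ∀ (B : Submodule ℚ (Finset ℕ → ℚ)) (f : Finset ℕ → Finset ℕ → ℚ),
      (∀ ρ ⊆ T, ¬ Q ρ → f ρ = 0) →
      (∀ e ⊆ T, e.card = 2 → ∑ v ∈ T \ e, faceSign v e • f (insert v e) ∈ B) →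
      ∀ ρ ⊆ T, ρ.card = 3 → f ρ ∈ B)
    (L : Finset (Finset ℕ)) (hL : IsComplex L) (hLT : ∀ ρ ∈ L, ρ ⊆ T)
    (hLQ : ∀ ρ ∈ L, Q ρ) (hL3 : ∀ ρ ∈ L, ρ.card ≤ 3) {n : ℕ} (hn : m + 2 < n) :
    CoeffVanishes (A ∪ T) (JoinPred A T P L) n := by
  induction L using Finset.strongInduction with
  | H L ih =>
  intro c hc hc0
  rcases L.eq_empty_or_nonempty with rfl | hne
  · refine ⟨0, fun σ hσ => absurd rfl hσ, fun τ hτ => ?_⟩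
    have : c τ = 0 := by
      by_contra h
      simpa using (hc τ h).1.2.2
    simp [coeffBdry, this]
  obtain ⟨ρ, hρ, hmax⟩ := exists_max_image L card hne
  have hρT := hLT ρ hρ
  have hIH : CoeffVanishes (A ∪ T) (JoinPred A T P (L.erase ρ)) n := by
    refine ih _ (erase_ssubset hρ) ?_ (fun r hr => hLT r (mem_of_mem_erase hr))
      (fun r hr => hLQ r (mem_of_mem_erase hr)) fun r hr => hL3 r (mem_of_mem_erase hr)
    intro σ hσ τ hτ
    obtain ⟨h1, h2⟩ := mem_erase.1 hσ
    refine mem_erase.2 ⟨?_, hL σ h2 τ hτ⟩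
    rintro rfl
    exact h1 (eq_of_subset_of_card_le hτ (hmax σ h2)).symm
  let a : Finset ℕ → Finset ℕ → ℚ := fun r τ => if τ ⊆ A then c (τ ∪ r) else 0
  have ha : ∀ r ⊆ T, ∀ p, p + r.card = n → IsCoeffChain P p (a r) := by
    intro r hr p hp τ hτ
    by_cases hA : τ ⊆ A
    · simp only [a, if_pos hA] at hτ
      obtain ⟨⟨_, h1, _⟩, h2⟩ := hc _ hτ
      rw [union_inter_lower hAT hA hr] at h1
      rw [card_union_of_lt hAT hA hr] at h2
      exact ⟨h1, by omega⟩
    · simp [a, hA] at hτ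
  have hsplit : ∀ r ⊆ T, ∀ τ ⊆ A, coeffBdry A (a r) τ +
      (-1) ^ τ.card * ∑ v ∈ T \ r, faceSign v r * c (τ ∪ insert v r) = 0 := by
    intro r hr τ hτ
    rw [← hc0 (τ ∪ r) (union_subset_union hτ hr), coeffBdry_union hAT c hτ hr]
    congr 1
    refine coeffBdry_congr (fun σ hσ => ?_) hτ
    simp [a, hσ]
  have hzero : ∀ τ ⊆ A, ∀ r ⊆ T, r ∉ L → c (τ ∪ r) = 0 := by
    intro τ hτ r hr hrL
    by_contra h
    have := (hc _ h).1.2.2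
    rw [union_inter_upper hAT hτ hr] at this
    exact hrL this
  obtain ⟨g, hg, hgc⟩ : ∃ g, IsCoeffChain P (n - ρ.card + 1) g ∧
      ∀ τ ⊆ A, coeffBdry A g τ = a ρ τ := by
    have hρ3 := hL3 ρ hρ
    rcases hρ3.lt_or_eq with hlt | heq
    · refine hvan (n - ρ.card) (by omega) (a ρ) (ha ρ hρT _ (by omega)) fun τ hτ => ?_
      have := hsplit ρ hρT τ hτ
      rwa [sum_eq_zero, mul_zero, add_zero] at this
      intro v hv
      obtain ⟨hvT, hvρ⟩ := mem_sdiff.1 hv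
      rw [hzero τ hτ _ (insert_subset hvT hρT), mul_zero]
      intro hmem
      have := hmax _ hmem
      rw [card_insert_of_notMem hvρ] at this
      omega
    · let B : Submodule ℚ (Finset ℕ → ℚ) :=
        { carrier := {x | ∃ g, IsCoeffChain P (n - ρ.card + 1) g ∧
            ∀ τ ⊆ A, coeffBdry A g τ = x τ}
          zero_mem' := ⟨0, fun σ hσ => absurd rfl hσ, fun τ _ => by simp [coeffBdry]⟩
          add_mem' := by
            rintro x y ⟨g, hg, hgx⟩ ⟨h, hh, hhy⟩
            refine ⟨fun σ => g σ + h σ, fun σ hσ => ?_, fun τ hτ => ?_⟩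
            · by_cases h0 : g σ = 0
              · exact hh σ (by simpa [h0] using hσ)
              · exact hg σ h0
            · rw [coeffBdry_add, hgx τ hτ, hhy τ hτ, Pi.add_apply]
          smul_mem' := by
            rintro r x ⟨g, hg, hgx⟩
            exact ⟨fun σ => r * g σ, fun σ hσ => hg σ (right_ne_zero_of_mul hσ),
              fun τ hτ => by rw [coeffBdry_mul_left, hgx τ hτ, Pi.smul_apply, smul_eq_mul]⟩ }
      refine htop B a ?_ ?_ ρ hρT heq
      · intro r hr hrQ
        funext τ
        by_cases hτ : τ ⊆ A
        · simp only [a, if_pos hτ, Pi.zero_apply]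
          exact hzero τ hτ r hr fun h => hrQ (hLQ r h)
        · simp [a, hτ]
      · intro e he he2
        refine ⟨fun σ => (-(-1) ^ (n - 3)) * a e σ, fun σ hσ => ?_, fun τ hτ => ?_⟩
        · exact ha e he _ (by omega) σ (right_ne_zero_of_mul hσ)
        · have hs : (∑ v ∈ T \ e, faceSign v e • a (insert v e)) τ =
              ∑ v ∈ T \ e, faceSign v e * c (τ ∪ insert v e) := by
            simp [Finset.sum_apply, a, hτ]
          have h1 := hsplit e he τ hτ
          rw [← hs] at h1
          rw [coeffBdry_mul_left]
          by_cases h0 : (∑ v ∈ T \ e, faceSign v e • a (insert v e)) τ = 0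
          · rw [h0, mul_zero, add_zero] at h1
            rw [h0, h1, mul_zero]
          · have hcard : τ.card = n - 3 := by
              rw [hs] at h0
              obtain ⟨v, hv, hv0⟩ := exists_ne_zero_of_sum_ne_zero h0
              obtain ⟨hvT, hve⟩ := mem_sdiff.1 hv
              have := (hc _ (right_ne_zero_of_mul hv0)).2
              rw [card_union_of_lt hAT hτ (insert_subset hvT he), card_insert_of_notMem hve] at this
              omega
            rw [hcard] at h1
            have hsq : ((-1 : ℚ) ^ (n - 3)) * (-1) ^ (n - 3) = 1 := by
              rw [← mul_pow]; simp
            linear_combination (-(-1 : ℚ) ^ (n - 3)) * h1 +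
              ((∑ v ∈ T \ e, faceSign v e • a (insert v e)) τ) * hsq
  have hρ3 := hL3 ρ hρ
  refine exists_push_off hAT hP hLT hL hc hc0 hρ (p := n - ρ.card + 1) (by omega) hg
    (fun τ hτ => ?_) hIH
  rw [hgc τ hτ]
  simp [a, hτ]

/-- The triangles of the triangulation of the projective plane with six vertices. -/
def rpTriangles : Finset (Finset (Fin 6)) :=
  {{0, 1, 3}, {0, 1, 5}, {0, 2, 3}, {0, 2, 4},
    {0, 4, 5}, {1, 2, 4}, {1, 2, 5}, {1, 3, 4}, {2, 3, 5}, {3, 4, 5}}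

/-- The faces of the triangulation of the projective plane with six vertices. -/
def IsRPFace (s : Finset (Fin 6)) : Prop := ∃ t ∈ rpTriangles, s ⊆ t

instance : DecidablePred IsRPFace := fun s =>
  inferInstanceAs (Decidable (∃ t ∈ rpTriangles, s ⊆ t))

theorem IsRPFace.mono {s t : Finset (Fin 6)} (ht : IsRPFace t) (hst : s ⊆ t) : IsRPFace s :=
  let ⟨u, hu, htu⟩ := ht
  ⟨u, hu, hst.trans htu⟩

theorem IsRPFace.card_le {s : Finset (Fin 6)} (hs : IsRPFace s) : s.card ≤ 3 := by
  revert s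
  decide

theorem IsRPFace.mem_rpTriangles {s : Finset (Fin 6)} (hs : IsRPFace s) (h3 : s.card = 3) :
    s ∈ rpTriangles := by
  obtain ⟨t, ht, hst⟩ := hs
  have : ∀ t ∈ rpTriangles, t.card = 3 := by decide
  rwa [eq_of_subset_of_card_le hst (by rw [this t ht, h3])]

theorem IsRPFace.exists_not_union {s : Finset (Fin 6)} (hs : IsRPFace s) (h : s.card < 3) :
    ∃ t u, IsRPFace t ∧ IsRPFace u ∧ s ⊆ t ∧ s ⊆ u ∧ ¬ IsRPFace (t ∪ u) := by
  have key : ∀ s : Finset (Fin 6), IsRPFace s → s.card < 3 → ∃ t ∈ rpTriangles,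
      ∃ u ∈ rpTriangles, s ⊆ t ∧ s ⊆ u ∧ ¬ IsRPFace (t ∪ u) := by decide
  obtain ⟨t, ht, u, hu, h1, h2, h3⟩ := key s hs h
  exact ⟨t, u, ⟨t, ht, Subset.rfl⟩, ⟨u, hu, Subset.rfl⟩, h1, h2, h3⟩

theorem rp_edge_relation {E : Type*} [AddCommGroup E] [Module ℚ E] {f : Finset (Fin 6) → E}
    (hf : ∀ s, ¬ IsRPFace s → f s = 0)
    (he : ∀ e : Finset (Fin 6), e.card = 2 →
      ∑ j ∈ eᶜ, (-1 : ℚ) ^ (e.filter (· < j)).card • f (insert j e) = 0)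
    (e : Finset (Fin 6)) (a b : Fin 6) (p q : ℕ) (s t : Finset (Fin 6))
    (h : e.card = 2 ∧ a ∉ e ∧ b ∉ e ∧ a ≠ b ∧ (e.filter (· < a)).card = p ∧
      (e.filter (· < b)).card = q ∧ insert a e = s ∧ insert b e = t ∧
      ∀ j, IsRPFace (insert j e) → j ∉ e → j = a ∨ j = b) :
    (-1 : ℚ) ^ p • f s + (-1 : ℚ) ^ q • f t = 0 := by
  obtain ⟨h2, ha, hb, hab, rfl, rfl, rfl, rfl, h⟩ := h
  rw [← he e h2, ← sum_pair hab (f := fun j =>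
    (-1 : ℚ) ^ (e.filter (· < j)).card • f (insert j e))]
  refine sum_subset ?_ fun j hj hj' => ?_
  · intro j hj
    rcases mem_insert.1 hj with rfl | hj
    · exact mem_compl.2 ha
    · exact mem_compl.2 (mem_singleton.1 hj ▸ hb)
  · rw [hf, smul_zero]
    intro hface
    simpa using hj' (by simpa using h j hface (mem_compl.1 hj))

/-- The six-vertex projective plane has no nonzero two-dimensional cycle with rational
coefficients. -/
theorem rp_eq_zero_of_cycle {E : Type*} [AddCommGroup E] [Module ℚ E] {f : Finset (Fin 6) → E}
    (hf : ∀ s, ¬ IsRPFace s → f s = 0)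
    (he : ∀ e : Finset (Fin 6), e.card = 2 →
      ∑ j ∈ eᶜ, (-1 : ℚ) ^ (e.filter (· < j)).card • f (insert j e) = 0)
    {s : Finset (Fin 6)} (hs : s.card = 3) : f s = 0 := by
  by_cases hface : IsRPFace s
  swap
  · exact hf s hface
  have h01 := rp_edge_relation hf he {0, 1} 3 5 2 2 {0, 1, 3} {0, 1, 5} (by decide)
  have h02 := rp_edge_relation hf he {0, 2} 3 4 2 2 {0, 2, 3} {0, 2, 4} (by decide)
  have h03 := rp_edge_relation hf he {0, 3} 1 2 1 1 {0, 1, 3} {0, 2, 3} (by decide)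
  have h05 := rp_edge_relation hf he {0, 5} 1 4 1 1 {0, 1, 5} {0, 4, 5} (by decide)
  have h13 := rp_edge_relation hf he {1, 3} 0 4 0 2 {0, 1, 3} {1, 3, 4} (by decide)
  have h14 := rp_edge_relation hf he {1, 4} 2 3 1 1 {1, 2, 4} {1, 3, 4} (by decide)
  have h15 := rp_edge_relation hf he {1, 5} 0 2 0 1 {0, 1, 5} {1, 2, 5} (by decide)
  have h23 := rp_edge_relation hf he {2, 3} 0 5 0 2 {0, 2, 3} {2, 3, 5} (by decide)
  have h34 := rp_edge_relation hf he {3, 4} 1 5 0 2 {1, 3, 4} {3, 4, 5} (by decide)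
  have h45 := rp_edge_relation hf he {4, 5} 0 3 0 0 {0, 4, 5} {3, 4, 5} (by decide)
  have t013 : f {0, 1, 3} = 0 := by
    linear_combination (norm := module) (1/2 : ℚ) • h13 + (-1/2 : ℚ) • h34 + (1/2 : ℚ) • h45 + (1/2 : ℚ) • h05 + (1/2 : ℚ) • h01
  have t015 : f {0, 1, 5} = 0 := by
    linear_combination (norm := module) (1 : ℚ) • h01 + (-1 : ℚ) • t013
  have t023 : f {0, 2, 3} = 0 := by
    linear_combination (norm := module) (-1 : ℚ) • h03 + (-1 : ℚ) • t013
  have t134 : f {1, 3, 4} = 0 := by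
    linear_combination (norm := module) (1 : ℚ) • h13 + (-1 : ℚ) • t013
  have t045 : f {0, 4, 5} = 0 := by
    linear_combination (norm := module) (-1 : ℚ) • h05 + (-1 : ℚ) • t015
  have t125 : f {1, 2, 5} = 0 := by
    linear_combination (norm := module) (-1 : ℚ) • h15 + (1 : ℚ) • t015
  have t024 : f {0, 2, 4} = 0 := by
    linear_combination (norm := module) (1 : ℚ) • h02 + (-1 : ℚ) • t023
  have t235 : f {2, 3, 5} = 0 := by
    linear_combination (norm := module) (1 : ℚ) • h23 + (-1 : ℚ) • t023
  have t124 : f {1, 2, 4} = 0 := by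
    linear_combination (norm := module) (-1 : ℚ) • h14 + (-1 : ℚ) • t134
  have t345 : f {3, 4, 5} = 0 := by
    linear_combination (norm := module) (1 : ℚ) • h34 + (-1 : ℚ) • t134
  have := hface.mem_rpTriangles hs
  simp only [rpTriangles, mem_insert, mem_singleton] at this
  rcases this with rfl | rfl | rfl | rfl | rfl | rfl | rfl | rfl | rfl | rfl <;> assumption

/-- The trace of `σ` on the six vertices `N, …, N + 5`. -/
def block (N : ℕ) (σ : Finset ℕ) : Finset (Fin 6) := univ.filter fun j => N + j ∈ σ

/-- The copy of `s` on the vertices `N, …, N + 5`. -/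
def unblock (N : ℕ) (s : Finset (Fin 6)) : Finset ℕ := s.image fun j : Fin 6 => N + (j : ℕ)

@[simp] theorem mem_block {N : ℕ} {σ : Finset ℕ} {j : Fin 6} : j ∈ block N σ ↔ N + j ∈ σ := by
  simp [block]

theorem mem_unblock {N : ℕ} {s : Finset (Fin 6)} {v : ℕ} :
    v ∈ unblock N s ↔ ∃ j ∈ s, N + (j : ℕ) = v := by
  simp [unblock]

theorem block_mono {N : ℕ} {σ τ : Finset ℕ} (h : σ ⊆ τ) : block N σ ⊆ block N τ :=
  fun _ hj => mem_block.2 (h (mem_block.1 hj))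

theorem exists_fin_of_mem_Ico {N v : ℕ} (h : v ∈ Ico N (N + 6)) : ∃ j : Fin 6, N + (j : ℕ) = v := by
  rw [mem_Ico] at h
  exact ⟨⟨v - N, by omega⟩, by simp; omega⟩

theorem unblock_subset (N : ℕ) (s : Finset (Fin 6)) : unblock N s ⊆ Ico N (N + 6) := by
  intro v hv
  obtain ⟨j, _, rfl⟩ := mem_unblock.1 hv
  simp

theorem block_unblock (N : ℕ) (s : Finset (Fin 6)) : block N (unblock N s) = s := by
  ext j
  simp [mem_unblock, Fin.val_inj]

theorem unblock_block {N : ℕ} {ρ : Finset ℕ} (hρ : ρ ⊆ Ico N (N + 6)) :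
    unblock N (block N ρ) = ρ := by
  ext v
  rw [mem_unblock]
  constructor
  · rintro ⟨j, hj, rfl⟩
    exact mem_block.1 hj
  · intro hv
    obtain ⟨j, rfl⟩ := exists_fin_of_mem_Ico (hρ hv)
    exact ⟨j, mem_block.2 hv, rfl⟩

theorem card_unblock (N : ℕ) (s : Finset (Fin 6)) : (unblock N s).card = s.card :=
  card_image_of_injective _ fun i j h => Fin.ext (by simpa using h)

theorem card_block {N : ℕ} {ρ : Finset ℕ} (hρ : ρ ⊆ Ico N (N + 6)) :
    (block N ρ).card = ρ.card := by
  rw [← card_unblock N, unblock_block hρ]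

theorem unblock_insert (N : ℕ) (j : Fin 6) (s : Finset (Fin 6)) :
    unblock N (insert j s) = insert (N + (j : ℕ)) (unblock N s) := by
  simp [unblock]

theorem faceSign_unblock (N : ℕ) (j : Fin 6) (s : Finset (Fin 6)) :
    faceSign (N + j) (unblock N s) = (-1) ^ (s.filter (· < j)).card := by
  rw [faceSign, ← card_unblock N]
  congr 2
  ext v
  simp only [mem_filter, mem_unblock]
  constructor
  · rintro ⟨⟨i, hi, rfl⟩, h⟩
    exact ⟨i, ⟨hi, by simpa using h⟩, rfl⟩
  · rintro ⟨i, ⟨hi, h⟩, rfl⟩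
    exact ⟨⟨i, hi, rfl⟩, by simpa using h⟩

theorem sum_sdiff_unblock {E : Type*} [AddCommMonoid E] (N : ℕ) (s : Finset (Fin 6))
    (F : ℕ → E) : ∑ v ∈ Ico N (N + 6) \ unblock N s, F v = ∑ j ∈ sᶜ, F (N + j) := by
  have : Ico N (N + 6) \ unblock N s = unblock N sᶜ := by
    ext v
    simp only [mem_sdiff, mem_unblock, mem_compl]
    constructor
    · rintro ⟨h1, h2⟩
      obtain ⟨j, rfl⟩ := exists_fin_of_mem_Ico h1
      exact ⟨j, fun hj => h2 ⟨j, hj, rfl⟩, rfl⟩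
    · rintro ⟨j, hj, rfl⟩
      refine ⟨by simp, ?_⟩
      rintro ⟨i, hi, h⟩
      exact hj ((Fin.ext (by simpa using h) : i = j) ▸ hi)
  rw [this, unblock, sum_image]
  intro i _ j _ h
  exact Fin.ext (by simpa using h)

/-- The join of `d` copies of the six-vertex projective plane. -/
def rpJoin (d : ℕ) : Finset (Finset ℕ) :=
  (range (6 * d)).powerset.filter fun σ => ∀ i < d, IsRPFace (block (6 * i) σ)

theorem mem_rpJoin {d : ℕ} {σ : Finset ℕ} :
    σ ∈ rpJoin d ↔ σ ⊆ range (6 * d) ∧ ∀ i < d, IsRPFace (block (6 * i) σ) := by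
  simp [rpJoin]

theorem isComplex_rpJoin (d : ℕ) : IsComplex (rpJoin d) := fun σ hσ τ hτ => by
  rw [mem_rpJoin] at hσ ⊢
  exact ⟨hτ.trans hσ.1, fun i hi => (hσ.2 i hi).mono (block_mono hτ)⟩

theorem range_union_Ico (d : ℕ) : range (6 * d) ∪ Ico (6 * d) (6 * d + 6) = range (6 * (d + 1)) := by
  ext v
  simp only [mem_union, mem_range, mem_Ico]
  omega

theorem lt_of_mem_range_of_mem_Ico (d : ℕ) :
    ∀ a ∈ range (6 * d), ∀ t ∈ Ico (6 * d) (6 * d + 6), a < t := by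
  intro a ha t ht
  simp only [mem_range, mem_Ico] at ha ht
  omega

theorem block_inter_range {d i : ℕ} (hi : i < d) (σ : Finset ℕ) :
    block (6 * i) (σ ∩ range (6 * d)) = block (6 * i) σ := by
  ext j
  simp only [mem_block, mem_inter, mem_range, and_iff_left_iff_imp]
  omega

theorem block_inter_Ico (N : ℕ) (σ : Finset ℕ) : block N (σ ∩ Ico N (N + 6)) = block N σ := by
  ext j
  simp

theorem inter_range_union_inter_Ico {d : ℕ} {σ : Finset ℕ} (hσ : σ ⊆ range (6 * (d + 1))) :
    (σ ∩ range (6 * d)) ∪ (σ ∩ Ico (6 * d) (6 * d + 6)) = σ := by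
  rw [← inter_union_distrib_left, range_union_Ico, inter_eq_left.2 hσ]

theorem card_eq_sum_card_block {d : ℕ} {σ : Finset ℕ} (hσ : σ ⊆ range (6 * d)) :
    σ.card = ∑ i ∈ range d, (block (6 * i) σ).card := by
  induction d generalizing σ with
  | zero => simpa using hσ
  | succ d ih =>
    rw [sum_range_succ, ← block_inter_Ico (6 * d) σ, card_block inter_subset_right,
      sum_congr rfl fun i hi => by rw [← block_inter_range (mem_range.1 hi) σ],
      ← ih inter_subset_right, ← card_union_of_lt (lt_of_mem_range_of_mem_Ico d)
        inter_subset_right inter_subset_right, inter_range_union_inter_Ico hσ]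

theorem mem_rpJoin_succ {d : ℕ} {σ : Finset ℕ} :
    σ ∈ rpJoin (d + 1) ↔ σ ⊆ range (6 * (d + 1)) ∧ σ ∩ range (6 * d) ∈ rpJoin d ∧
      IsRPFace (block (6 * d) σ) := by
  simp only [mem_rpJoin, inter_subset_right, true_and]
  refine and_congr_right fun _ => ⟨fun h => ⟨fun i hi => ?_, h d (by omega)⟩, fun h i hi => ?_⟩
  · rw [block_inter_range hi]
    exact h i (by omega)
  · rcases (Nat.lt_succ_iff_lt_or_eq.1 hi) with hi | rfl
    · rw [← block_inter_range hi]
      exact h.1 i hi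
    · exact h.2

/-- Chains on induced subcomplexes of `rpJoin d` have no homology in dimension `2 * d` and above. -/
theorem coeffVanishes_rpJoin (X : Finset ℕ) (d n : ℕ) (hn : 2 * d < n) :
    CoeffVanishes (range (6 * d)) (fun σ => σ ∈ rpJoin d ∧ σ ⊆ X) n := by
  induction d generalizing n with
  | zero =>
    intro c hc _
    refine ⟨0, fun σ hσ => absurd rfl hσ, fun τ hτ => ?_⟩
    have : c τ = 0 := by
      by_contra h
      obtain ⟨_, h2⟩ := hc τ h
      have : τ = ∅ := by simpa using hτ
      rw [this, card_empty] at h2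
      omega
    simp [coeffBdry, this]
  | succ d ih =>
    have key := coeffVanishes_join (lt_of_mem_range_of_mem_Ico d)
      (P := fun σ => σ ∈ rpJoin d ∧ σ ⊆ X)
      (fun σ hσ τ hτ => ⟨isComplex_rpJoin d σ hσ.1 τ hτ, hτ.trans hσ.2⟩) (m := 2 * d) ih
      (fun ρ => IsRPFace (block (6 * d) ρ)) ?_
      ((Ico (6 * d) (6 * d + 6) ∩ X).powerset.filter fun ρ => IsRPFace (block (6 * d) ρ))
      ?_ ?_ ?_ ?_ (n := n) (by omega)
    · rw [range_union_Ico] at key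
      convert key using 2 with σ
      simp only [JoinPred, mem_rpJoin_succ, mem_filter, mem_powerset, block_inter_Ico,
        range_union_Ico]
      constructor
      · rintro ⟨⟨h1, h2, h3⟩, h4⟩
        exact ⟨h1, ⟨h2, inter_subset_left.trans h4⟩,
          subset_inter inter_subset_right (inter_subset_left.trans h4), h3⟩
      · rintro ⟨h1, ⟨h2, h3⟩, h4, h5⟩
        refine ⟨⟨h1, h2, h5⟩, ?_⟩
        rw [← inter_range_union_inter_Ico h1]
        exact union_subset h3 (h4.trans inter_subset_right)
    · intro B f hf he ρ hρ h3
      rw [← Submodule.Quotient.mk_eq_zero B]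
      have := rp_eq_zero_of_cycle (f := fun s => B.mkQ (f (unblock (6 * d) s))) ?_ ?_
        (s := block (6 * d) ρ) (by rw [card_block hρ, h3])
      · simpa [unblock_block hρ] using this
      · intro s hs
        rw [hf _ (unblock_subset _ _) (by rwa [block_unblock]), map_zero]
      · intro e he2
        have := he (unblock (6 * d) e) (unblock_subset _ _) (by rw [card_unblock, he2])
        rw [sum_sdiff_unblock, ← Submodule.Quotient.mk_eq_zero B, ← Submodule.mkQ_apply,
          map_sum] at this
        rw [← this]
        refine sum_congr rfl fun j _ => ?_
        rw [faceSign_unblock, map_smul, unblock_insert]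
    · intro σ hσ τ hτ
      simp only [mem_filter, mem_powerset] at hσ ⊢
      exact ⟨hτ.trans hσ.1, hσ.2.mono (block_mono hτ)⟩
    · intro ρ hρ
      simp only [mem_filter, mem_powerset] at hρ
      exact hρ.1.trans inter_subset_left
    · intro ρ hρ
      exact (mem_filter.1 hρ).2
    · intro ρ hρ
      simp only [mem_filter, mem_powerset] at hρ
      rw [← card_block (hρ.1.trans inter_subset_left)]
      exact hρ.2.card_le

theorem bdry_apply {S : Finset ℕ} (c : Finset ℕ →₀ ℚ) (hc : ∀ σ ∈ c.support, σ ⊆ S)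
    (τ : Finset ℕ) : bdry c τ = coeffBdry S c τ := by
  have h1 : bdry c τ = ∑ σ ∈ c.support, ∑ v ∈ S,
      if v ∈ σ ∧ σ.erase v = τ then c σ * (-1) ^ (σ.filter (· < v)).card else 0 := by
    rw [bdry, Finsupp.lsum_apply, Finsupp.sum, Finsupp.finsetSum_apply]
    refine sum_congr rfl fun σ hσ => ?_
    rw [LinearMap.toSpanSingleton_apply, Finsupp.smul_apply, Finsupp.finsetSum_apply, smul_eq_mul,
      mul_sum, ← sum_subset (hc σ hσ)]
    · refine sum_congr rfl fun v hv => ?_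
      simp [hv, Finsupp.single_apply]
    · intro v _ hv
      simp [hv]
  rw [h1, sum_comm, coeffBdry, ← sum_subset sdiff_subset]
  · refine sum_congr rfl fun v hv => ?_
    have hvτ := (mem_sdiff.1 hv).2
    have hiff : ∀ σ : Finset ℕ, (v ∈ σ ∧ σ.erase v = τ) ↔ σ = insert v τ := by
      refine fun σ => ⟨?_, ?_⟩
      · rintro ⟨h, rfl⟩
        exact (insert_erase h).symm
      · rintro rfl
        exact ⟨mem_insert_self _ _, erase_insert hvτ⟩
    simp only [hiff]
    rw [sum_ite_eq']
    split_ifs with h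
    · rw [faceSign, filter_insert, if_neg (lt_irrefl v), mul_comm]
    · rw [Finsupp.notMem_support_iff.1 h, mul_zero]
  · intro v hvS hv
    have hvτ : v ∈ τ := by
      by_contra h
      exact hv (mem_sdiff.2 ⟨hvS, h⟩)
    refine sum_eq_zero fun σ _ => if_neg ?_
    rintro ⟨_, rfl⟩
    exact notMem_erase v σ hvτ

theorem coeffBdry_eq_zero_of_not_subset {S : Finset ℕ} {c : Finset ℕ → ℚ}
    (hc : ∀ σ, c σ ≠ 0 → σ ⊆ S) {τ : Finset ℕ} (hτ : ¬ τ ⊆ S) : coeffBdry S c τ = 0 :=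
  sum_eq_zero fun v _ => by
    rw [not_not.1 fun h => hτ ((subset_insert v τ).trans (hc _ h)), mul_zero]

theorem homologyVanishes_of_coeffVanishes {S : Finset ℕ} {K : Finset (Finset ℕ)}
    (hK : ∀ σ ∈ K, σ ⊆ S) {k : ℕ} (h : CoeffVanishes S (· ∈ K) (k + 1)) :
    HomologyVanishes K k := by
  intro c hc hc0
  have hcS : ∀ σ ∈ c.support, σ ⊆ S := fun σ hσ => hK σ (hc σ hσ).1
  obtain ⟨b, hb, hbc⟩ := h c (fun σ hσ => hc σ (Finsupp.mem_support_iff.2 hσ)) fun τ _ => by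
    rw [← bdry_apply c hcS, hc0, Finsupp.zero_apply]
  have hbS : ∀ σ, b σ ≠ 0 → σ ⊆ S := fun σ hσ => hK σ (hb σ hσ).1
  refine ⟨Finsupp.onFinset S.powerset b fun σ hσ => mem_powerset.2 (hbS σ hσ),
    fun σ hσ => hb σ (by simpa using hσ), ?_⟩
  ext τ
  rw [bdry_apply (S := S) _ fun σ hσ => hbS σ (by simpa using hσ), Finsupp.coe_onFinset]
  by_cases hτ : τ ⊆ S
  · exact hbc τ hτ
  · rw [coeffBdry_eq_zero_of_not_subset hbS hτ]
    by_contra h0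
    exact hτ (hcS τ (Finsupp.mem_support_iff.2 (Ne.symm h0)))

theorem mem_inducedSub {K : Finset (Finset ℕ)} (hK : IsComplex K) {X σ : Finset ℕ} :
    σ ∈ InducedSub K X ↔ σ ∈ K ∧ σ ⊆ X := by
  rw [InducedSub, mem_image]
  constructor
  · rintro ⟨τ, hτ, rfl⟩
    exact ⟨hK τ hτ _ inter_subset_left, inter_subset_right⟩
  · rintro ⟨h1, h2⟩
    exact ⟨σ, h1, inter_eq_left.2 h2⟩

theorem isLeray_rpJoin (d : ℕ) : IsLeray (2 * d) (rpJoin d) := by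
  intro X k hk
  refine homologyVanishes_of_coeffVanishes (S := range (6 * d)) (fun σ hσ => ?_) ?_
  · exact (mem_rpJoin.1 ((mem_inducedSub (isComplex_rpJoin d)).1 hσ).1).1
  · simp only [mem_inducedSub (isComplex_rpJoin d)]
    exact coeffVanishes_rpJoin X d (k + 1) (by omega)

/-- The boundary of the missing triangle `{0, 1, 2}` of the projective plane. -/
def hollowTriangle (s : Finset (Fin 6)) : ℤ :=
  if s = {0, 1} ∨ s = {1, 2} then 1 else if s = {0, 2} then -1 else 0

theorem hollowTriangle_ne_zero {s : Finset (Fin 6)} (h : hollowTriangle s ≠ 0) :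
    IsRPFace s ∧ s.card = 2 ∧ s ⊆ {0, 1, 2} := by
  have : s = {0, 1} ∨ s = {1, 2} ∨ s = {0, 2} := by
    by_contra h'
    exact h (by simp_all [hollowTriangle])
  rcases this with rfl | rfl | rfl <;> decide

theorem hollowTriangle_cycle (s : Finset (Fin 6)) :
    ∑ j ∈ sᶜ, (-1 : ℚ) ^ (s.filter (· < j)).card * hollowTriangle (insert j s) = 0 := by
  have key : ∀ s : Finset (Fin 6),
      ∑ j ∈ sᶜ, (-1 : ℤ) ^ (s.filter (· < j)).card * hollowTriangle (insert j s) = 0 := by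
    decide
  exact_mod_cast key s

theorem exists_cycle_rpJoin (d : ℕ) : ∃ c : Finset ℕ → ℚ,
    IsCoeffChain (fun σ => σ ∈ rpJoin d ∧ ∀ v ∈ σ, v % 6 < 3) (2 * d) c ∧ c ≠ 0 ∧
      ∀ τ ⊆ range (6 * d), coeffBdry (range (6 * d)) c τ = 0 := by
  induction d with
  | zero =>
    refine ⟨fun σ => if σ = ∅ then 1 else 0, fun σ hσ => ?_, fun h => ?_, fun τ _ => ?_⟩
    · have : σ = ∅ := by simpa using hσ
      subst this
      simp [mem_rpJoin]
    · simpa using congr_fun h ∅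
    · simp [coeffBdry]
  | succ d ih =>
    obtain ⟨c, hc, hne, hc0⟩ := ih
    have hAT := lt_of_mem_range_of_mem_Ico d
    refine ⟨fun σ => if σ ⊆ range (6 * (d + 1)) then
      c (σ ∩ range (6 * d)) * hollowTriangle (block (6 * d) σ) else 0, ?_, ?_, ?_⟩
    · intro σ hσ
      by_cases hS : σ ⊆ range (6 * (d + 1))
      swap
      · simp [hS] at hσ
      simp only [if_pos hS] at hσ
      obtain ⟨⟨h1, h2⟩, h3⟩ := hc _ (left_ne_zero_of_mul hσ)
      obtain ⟨h4, h5, h6⟩ := hollowTriangle_ne_zero (Int.cast_ne_zero.1 (right_ne_zero_of_mul hσ))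
      rw [← block_inter_Ico, card_block inter_subset_right] at h5
      refine ⟨⟨mem_rpJoin_succ.2 ⟨hS, h1, h4⟩, fun v hv => ?_⟩, ?_⟩
      · by_cases hvd : v < 6 * d
        · exact h2 v (mem_inter.2 ⟨hv, mem_range.2 hvd⟩)
        · have hv' := mem_range.1 (hS hv)
          obtain ⟨j, rfl⟩ := exists_fin_of_mem_Ico (N := 6 * d) (v := v)
            (mem_Ico.2 ⟨by omega, by omega⟩)
          have hj := h6 (mem_block.2 hv)
          have : ∀ j : Fin 6, j ∈ ({0, 1, 2} : Finset (Fin 6)) → (j : ℕ) < 3 := by decide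
          have := this j hj
          omega
      · rw [← inter_range_union_inter_Ico hS, card_union_of_lt hAT inter_subset_right
          inter_subset_right, h3, h5]
        ring
    · obtain ⟨τ, hτ⟩ := Function.ne_iff.1 hne
      have hτA := (mem_rpJoin.1 (hc τ hτ).1.1).1
      have hU := unblock_subset (6 * d) {0, 1}
      intro h
      have h0 := congr_fun h (τ ∪ unblock (6 * d) {0, 1})
      simp only [union_inter_lower hAT hτA hU] at h0
      rw [if_pos (by rw [← range_union_Ico]; exact union_subset_union hτA hU), ← block_inter_Ico,
        union_inter_upper hAT hτA hU, block_unblock] at h0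
      simp [hollowTriangle] at h0
      exact hτ h0
    · intro σ hσ
      have hA : σ ∩ range (6 * d) ⊆ range (6 * d) := inter_subset_right
      have hT : σ ∩ Ico (6 * d) (6 * d + 6) ⊆ Ico (6 * d) (6 * d + 6) := inter_subset_right
      rw [← inter_range_union_inter_Ico hσ]
      generalize σ ∩ range (6 * d) = τ at hA
      generalize σ ∩ Ico (6 * d) (6 * d + 6) = ρ at hT
      have hval : ∀ τ ⊆ range (6 * d), ∀ ρ ⊆ Ico (6 * d) (6 * d + 6),
          (if τ ∪ ρ ⊆ range (6 * (d + 1)) then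
            c ((τ ∪ ρ) ∩ range (6 * d)) * hollowTriangle (block (6 * d) (τ ∪ ρ)) else 0) =
          c τ * hollowTriangle (block (6 * d) ρ) := by
        intro τ hτ ρ hρ
        rw [if_pos (by rw [← range_union_Ico]; exact union_subset_union hτ hρ),
          union_inter_lower hAT hτ hρ, ← block_inter_Ico, union_inter_upper hAT hτ hρ]
      rw [← range_union_Ico, coeffBdry_union hAT _ hA hT]
      rw [coeffBdry_congr (c := fun τ => (hollowTriangle (block (6 * d) ρ) : ℚ) * c τ) _ hA,
        coeffBdry_mul_left, hc0 τ hA, mul_zero, zero_add]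
      · refine mul_eq_zero_of_right _ ?_
        rw [← unblock_block hT, sum_sdiff_unblock]
        calc _ = ∑ j ∈ (block (6 * d) ρ)ᶜ, c τ * ((-1) ^ ((block (6 * d) ρ).filter (· < j)).card *
              hollowTriangle (insert j (block (6 * d) ρ))) := sum_congr rfl fun j _ => by
              rw [range_union_Ico, ← unblock_insert, hval τ hA _ (unblock_subset _ _),
                block_unblock, faceSign_unblock]
              ring
          _ = 0 := by rw [← mul_sum, hollowTriangle_cycle, mul_zero]
      · intro τ' hτ'
        rw [range_union_Ico, hval τ' hτ' ρ hT, mul_comm]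

theorem not_isLeray_rpJoin {d d' : ℕ} (h : d' < 2 * d) : ¬ IsLeray d' (rpJoin d) := by
  intro hL
  obtain ⟨c, hc, hne, hc0⟩ := exists_cycle_rpJoin d
  set X := (range (6 * d)).filter fun v => v % 6 < 3
  have hcS : ∀ σ, c σ ≠ 0 → σ ⊆ range (6 * d) := fun σ hσ => (mem_rpJoin.1 (hc σ hσ).1.1).1
  let c' : Finset ℕ →₀ ℚ := Finsupp.onFinset (range (6 * d)).powerset c
    fun σ hσ => mem_powerset.2 (hcS σ hσ)
  have hc' : IsChainOn (InducedSub (rpJoin d) X) (2 * d - 1 + 1) c' := by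
    intro σ hσ
    obtain ⟨⟨h1, h2⟩, h3⟩ := hc σ (by simpa [c'] using hσ)
    refine ⟨(mem_inducedSub (isComplex_rpJoin d)).2 ⟨h1, fun v hv => ?_⟩, by omega⟩
    exact mem_filter.2 ⟨(mem_rpJoin.1 h1).1 hv, h2 v hv⟩
  have hc0' : bdry c' = 0 := by
    ext τ
    rw [bdry_apply (S := range (6 * d)) _ fun σ hσ => hcS σ (by simpa [c'] using hσ)]
    by_cases hτ : τ ⊆ range (6 * d)
    · exact hc0 τ hτ
    · exact coeffBdry_eq_zero_of_not_subset hcS hτ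
  obtain ⟨b, hb, hbc⟩ := hL X (2 * d - 1) (by omega) c' hc' hc0'
  have hb0 : b = 0 := by
    rw [← Finsupp.support_eq_empty, eq_empty_iff_forall_notMem]
    intro σ hσ
    obtain ⟨h1, h2⟩ := hb σ hσ
    obtain ⟨h3, h4⟩ := (mem_inducedSub (isComplex_rpJoin d)).1 h1
    obtain ⟨h5, h6⟩ := mem_rpJoin.1 h3
    have hle : ∀ i ∈ range d, (block (6 * i) σ).card ≤ 2 := by
      intro i hi
      have key : ∀ s : Finset (Fin 6), IsRPFace s → (∀ j ∈ s, (j : ℕ) < 3) → s.card ≤ 2 := by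
        decide
      refine key _ (h6 i (mem_range.1 hi)) fun j hj => ?_
      have := (mem_filter.1 (h4 (mem_block.1 hj))).2
      omega
    have := sum_le_sum hle
    rw [← card_eq_sum_card_block h5, sum_const, card_range, smul_eq_mul] at this
    omega
  rw [hb0, map_zero] at hbc
  apply hne
  funext σ
  exact (DFunLike.congr_fun hbc σ).symm

/-- A complex whose faces have at most `m` vertices is `m`-collapsible. -/
theorem collapsible_of_card_le {V : Type*} [DecidableEq V] {m : ℕ} (K : Finset (Finset V))
    (hK : ∀ σ ∈ K, σ.card ≤ m) : Collapsible m K := by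
  induction K using Finset.strongInduction with
  | H K ih =>
  rcases K.eq_empty_or_nonempty with rfl | hne
  · exact Relation.ReflTransGen.refl
  obtain ⟨σ, hσ, hmax⟩ := exists_max_image K card hne
  have hσmax : ∀ ρ ∈ K, σ ⊆ ρ → ρ = σ := fun ρ hρ h =>
    (eq_of_subset_of_card_le h (hmax ρ hρ)).symm
  refine Relation.ReflTransGen.head ⟨σ, σ, hσ, hK σ hσ, ⟨hσ, Subset.rfl, hσmax⟩,
    fun τ' hτ' h _ => hσmax τ' hτ' h, rfl⟩ (ih _ (filter_ssubset.2 ⟨σ, hσ, by simp⟩) ?_)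
  exact fun τ hτ => hK τ (mem_filter.1 hτ).1

theorem card_le_of_mem_rpJoin {d : ℕ} {σ : Finset ℕ} (hσ : σ ∈ rpJoin d) : σ.card ≤ 3 * d := by
  obtain ⟨h1, h2⟩ := mem_rpJoin.1 hσ
  rw [card_eq_sum_card_block h1]
  refine (sum_le_sum fun i hi => (h2 i (mem_range.1 hi)).card_le).trans ?_
  simp [mul_comm]

theorem union_unblock_mem_rpJoin {d i : ℕ} (hi : i < d) {σ : Finset ℕ} (hσ : σ ∈ rpJoin d)
    {t : Finset (Fin 6)} (ht : IsRPFace t) (hst : block (6 * i) σ ⊆ t) :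
    σ ∪ unblock (6 * i) t ∈ rpJoin d := by
  obtain ⟨h1, h2⟩ := mem_rpJoin.1 hσ
  refine mem_rpJoin.2 ⟨union_subset h1 fun v hv => ?_, fun k hk => ?_⟩
  · have := mem_Ico.1 (unblock_subset _ _ hv)
    exact mem_range.2 (by omega)
  · rcases eq_or_ne k i with rfl | hki
    · refine ht.mono fun j hj => ?_
      rcases mem_union.1 (mem_block.1 hj) with hj | hj
      · exact hst (mem_block.2 hj)
      · rw [← block_unblock (6 * k) t]
        exact mem_block.2 hj
    · refine (h2 k hk).mono fun j hj => ?_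
      rcases mem_union.1 (mem_block.1 hj) with hj | hj
      · exact mem_block.2 hj
      · have := mem_Ico.1 (unblock_subset _ _ hj)
        omega

theorem not_collapsible_rpJoin {d d' : ℕ} (h : d' < 3 * d) : ¬ Collapsible d' (rpJoin d) := by
  intro hcol
  have hempty : ∅ ∈ rpJoin d := by
    refine mem_rpJoin.2 ⟨empty_subset _, fun i _ => ?_⟩
    have : block (6 * i) ∅ = ∅ := by simp [block]
    rw [this]
    decide
  rcases Relation.ReflTransGen.cases_head hcol with h0 | ⟨_, ⟨σ, τ, hσ, hσd, -, huniq, -⟩, -⟩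
  · simp [h0] at hempty
  obtain ⟨h1, h2⟩ := mem_rpJoin.1 hσ
  obtain ⟨i, hi, hi3⟩ : ∃ i < d, (block (6 * i) σ).card < 3 := by
    by_contra! hge
    have := sum_le_sum fun i hi => hge i (mem_range.1 hi)
    rw [← card_eq_sum_card_block h1, sum_const, card_range, smul_eq_mul] at this
    omega
  have hsub : ∀ η ∈ rpJoin d, σ ⊆ η → τ ∈ rpJoin d ∧ η ⊆ τ := by
    intro η hη hση
    obtain ⟨ρ, hρ, hmax⟩ := exists_max_image ((rpJoin d).filter (η ⊆ ·)) card
      ⟨η, mem_filter.2 ⟨hη, Subset.rfl⟩⟩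
    obtain ⟨hρK, hηρ⟩ := mem_filter.1 hρ
    have := huniq ρ hρK (hση.trans hηρ) fun ξ hξ hρξ =>
      (eq_of_subset_of_card_le hρξ (hmax ξ (mem_filter.2 ⟨hξ, hηρ.trans hρξ⟩))).symm
    exact this ▸ ⟨hρK, hηρ⟩
  obtain ⟨t, u, ht, hu, hst, hsu, htu⟩ := (h2 i hi).exists_not_union hi3
  obtain ⟨hτ, h3⟩ := hsub _ (union_unblock_mem_rpJoin hi hσ ht hst) subset_union_left
  obtain ⟨-, h4⟩ := hsub _ (union_unblock_mem_rpJoin hi hσ hu hsu) subset_union_left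
  refine htu (((mem_rpJoin.1 hτ).2 i hi).mono (union_subset ?_ ?_))
  · rw [← block_unblock (6 * i) t]
    exact block_mono (subset_union_right.trans h3)
  · rw [← block_unblock (6 * i) u]
    exact block_mono (subset_union_right.trans h4)

/-- For every `d ≥ 1` there is a finite simplicial complex `K` whose Leray number
(least `d'` such that `K` is `d'`-Leray) equals `2d` and whose collapsibility number
(least `d'` such that `K` is `d'`-collapsible) equals `3d`. -/
theorem leray_not_collapsible_gap (d : ℕ) (hd : 1 ≤ d) :
    ∃ K : Finset (Finset ℕ), IsComplex K ∧
      IsLeast {d' : ℕ | IsLeray d' K} (2 * d) ∧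
      IsLeast {d' : ℕ | Collapsible d' K} (3 * d) := by
  refine ⟨rpJoin d, isComplex_rpJoin d, ⟨isLeray_rpJoin d, fun d' h => ?_⟩,
    ⟨collapsible_of_card_le _ fun σ hσ => card_le_of_mem_rpJoin hσ, fun d' h => ?_⟩⟩
  · by_contra! hlt
    exact not_isLeray_rpJoin hlt h
  · by_contra! hlt
    exact not_collapsible_rpJoin hlt h
end

section
/- Let L be a finite abstract simplicial complex such that the nerve of the family of nonempty faces of L is d-representable. Then L embeds linearly in ℝ^d: there exists a map p from the vertex set of L to ℝ^d such that for every face σ ∈ L the point set p(σ) is affinely independent, and for every two faces σ, τ ∈ L one has conv(p(σ)) ∩ conv(p(τ)) = conv(p(σ ∩ τ)). -/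
open Classical in
/-- The nerve of the family of nonempty faces of `L`: a finite subfamily of nonempty
faces of `L` is a simplex iff the faces in it have a common vertex. -/
noncomputable def nerveFaces {V : Type*} [DecidableEq V] (L : Finset (Finset V)) :
    Finset (Finset (Finset V)) :=
  (L.filter fun σ => σ.Nonempty).powerset.filter (fun G => ∃ v, ∀ σ ∈ G, v ∈ σ)

/-- A sum whose terms vanish where the weight `w` does splits into the sums over the positive and
over the negative weights. -/
theorem sum_eq_sum_pos_add_sum_neg {V M : Type*} [AddCommMonoid M] (s : Finset V) (w : V → ℝ)
    (f : V → M) (hf : ∀ i, w i = 0 → f i = 0) :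
    ∑ i ∈ s, f i = ∑ i ∈ s with 0 < w i, f i + ∑ i ∈ s with w i < 0, f i := by
  simp only [Finset.sum_filter, ← Finset.sum_add_distrib]
  refine Finset.sum_congr rfl fun i _ => ?_
  rcases lt_trichotomy (w i) 0 with h | h | h
  · simp [h, h.le.not_gt]
  · simp [h, hf i h]
  · simp [h, h.le.not_gt]

/-- If any two disjoint faces of a complex have images with disjoint convex hulls, then a vanishing
affine relation whose positive and negative parts are supported on faces is trivial. -/
theorem eq_zero_of_disjoint_convexHull {V E : Type*} [DecidableEq V] [AddCommGroup E] [Module ℝ E]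
    {L : Finset (Finset V)} {p : V → E}
    (hp : ∀ σ ∈ L, ∀ τ ∈ L, Disjoint σ τ →
      Disjoint (convexHull ℝ (p '' (σ : Set V))) (convexHull ℝ (p '' (τ : Set V))))
    {s : Finset V} {w : V → ℝ} (hw : ∑ i ∈ s, w i = 0) (hwp : ∑ i ∈ s, w i • p i = 0)
    (hpos : {i ∈ s | 0 < w i} ∈ L) (hneg : {i ∈ s | w i < 0} ∈ L) :
    ∀ i ∈ s, w i = 0 := by
  have hle : ∀ i ∈ s, w i ≤ 0 := by
    intro j hj
    by_contra! hwj
    have hposj : 0 < ∑ i ∈ s with 0 < w i, w i :=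
      Finset.sum_pos (fun i hi => (Finset.mem_filter.1 hi).2) ⟨j, by simp [hj, hwj]⟩
    have hsum := (sum_eq_sum_pos_add_sum_neg s w w fun _ h => h).symm.trans hw
    have hsump := (sum_eq_sum_pos_add_sum_neg s w (fun i => w i • p i)
      fun i h => by simp [h]).symm.trans hwp
    have hnegsum : ∑ i ∈ s with w i < 0, -w i = ∑ i ∈ s with 0 < w i, w i := by
      rw [Finset.sum_neg_distrib]; linarith
    have hposmem : Finset.centerMass {i ∈ s | 0 < w i} w p ∈
        convexHull ℝ (p '' (({i ∈ s | 0 < w i} : Finset V) : Set V)) :=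
      Finset.centerMass_mem_convexHull _ (fun i hi => (Finset.mem_filter.1 hi).2.le) hposj
        fun i hi => Set.mem_image_of_mem p hi
    have hnegmem : Finset.centerMass {i ∈ s | w i < 0} (fun i => -w i) p ∈
        convexHull ℝ (p '' (({i ∈ s | w i < 0} : Finset V) : Set V)) :=
      Finset.centerMass_mem_convexHull _
        (fun i hi => neg_nonneg.2 (Finset.mem_filter.1 hi).2.le) (hnegsum ▸ hposj)
        fun i hi => Set.mem_image_of_mem p hi
    have heq : Finset.centerMass {i ∈ s | w i < 0} (fun i => -w i) p =
        Finset.centerMass {i ∈ s | 0 < w i} w p := by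
      simp only [Finset.centerMass, hnegsum, neg_smul, Finset.sum_neg_distrib]
      rw [← eq_neg_of_add_eq_zero_left hsump]
    refine Set.disjoint_left.1 (hp _ hpos _ hneg ?_) hposmem (heq ▸ hnegmem)
    exact Finset.disjoint_filter.2 fun i _ h => h.le.not_gt
  exact (Finset.sum_eq_zero_iff_of_nonpos hle).1 hw

/-- A point of the convex hull of the image of a finset is a convex combination with weights
vanishing off that finset. -/
theorem exists_weights_of_mem_convexHull_image {V E : Type*} [AddCommGroup E] [Module ℝ E]
    {p : V → E} {σ : Finset V} {x : E} (hx : x ∈ convexHull ℝ (p '' (σ : Set V))) :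
    ∃ w : V → ℝ, (∀ i, 0 ≤ w i) ∧ (∀ i ∉ σ, w i = 0) ∧ ∑ i ∈ σ, w i = 1 ∧
      ∑ i ∈ σ, w i • p i = x := by
  classical
  refine convexHull_min (t := {x | ∃ w : V → ℝ, (∀ i, 0 ≤ w i) ∧ (∀ i ∉ σ, w i = 0) ∧
    ∑ i ∈ σ, w i = 1 ∧ ∑ i ∈ σ, w i • p i = x}) ?_ ?_ hx
  · rintro _ ⟨i, hi, rfl⟩
    have hi' : i ∈ σ := hi
    refine ⟨Pi.single i 1, fun j => ?_, fun j hj => ?_, ?_, ?_⟩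
    · by_cases h : j = i <;> simp [h]
    · simp [(ne_of_mem_of_not_mem hi' hj).symm]
    · simp [Pi.single_apply, hi']
    · simp [Pi.single_apply, ite_smul, hi']
  · rintro _ ⟨u, hu, hu0, hu1, rfl⟩ _ ⟨v, hv, hv0, hv1, rfl⟩ a b ha hb hab
    refine ⟨fun i => a * u i + b * v i, fun i => by have := hu i; have := hv i; positivity,
      fun i hi => by simp [hu0 i hi, hv0 i hi], ?_, ?_⟩
    · simp [Finset.sum_add_distrib, ← Finset.mul_sum, hu1, hv1, hab]
    · simp [Finset.sum_add_distrib, add_smul, mul_smul, ← Finset.smul_sum]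

/-- A map for which disjoint faces have images with disjoint convex hulls sends every face to an
affinely independent set. -/
theorem affineIndependent_image_of_disjoint_convexHull {V E : Type*} [DecidableEq V]
    [AddCommGroup E] [Module ℝ E] {L : Finset (Finset V)} (hL : IsComplex L) {p : V → E}
    (hp : ∀ σ ∈ L, ∀ τ ∈ L, Disjoint σ τ →
      Disjoint (convexHull ℝ (p '' (σ : Set V))) (convexHull ℝ (p '' (τ : Set V))))
    {σ : Finset V} (hσ : σ ∈ L) :
    AffineIndependent ℝ ((↑) : (p '' (σ : Set V)) → E) := by
  have hind : AffineIndependent ℝ (fun i : σ => p i) := by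
    rw [affineIndependent_iff_of_fintype]
    intro w hw hwp i
    rw [Finset.univ.weightedVSub_eq_linear_combination hw] at hwp
    have hext (i : σ) : Function.extend Subtype.val w 0 (i : V) = w i :=
      Subtype.val_injective.extend_apply w 0 i
    rw [← hext i]
    refine eq_zero_of_disjoint_convexHull hp ?_ ?_
      (hL σ hσ _ (Finset.filter_subset _ _)) (hL σ hσ _ (Finset.filter_subset _ _)) i i.2
    · rw [← Finset.sum_coe_sort]
      simpa only [hext] using hw
    · rw [← Finset.sum_coe_sort]
      simpa only [hext] using hwp
  have hrange : Set.range (fun i : σ => p i) = p '' (σ : Set V) := by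
    ext; simp
  exact hrange ▸ hind.range

/-- A map for which disjoint faces have images with disjoint convex hulls sends any two faces to
simplices that meet in the image of the common face. -/
theorem convexHull_image_inter_of_disjoint_convexHull {V E : Type*} [DecidableEq V]
    [AddCommGroup E] [Module ℝ E] {L : Finset (Finset V)} (hL : IsComplex L) {p : V → E}
    (hp : ∀ σ ∈ L, ∀ τ ∈ L, Disjoint σ τ →
      Disjoint (convexHull ℝ (p '' (σ : Set V))) (convexHull ℝ (p '' (τ : Set V))))
    {σ τ : Finset V} (hσ : σ ∈ L) (hτ : τ ∈ L) :
    convexHull ℝ (p '' (σ : Set V)) ∩ convexHull ℝ (p '' (τ : Set V)) =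
      convexHull ℝ (p '' ((σ ∩ τ : Finset V) : Set V)) := by
  refine Set.Subset.antisymm ?_ (Set.subset_inter
    (convexHull_mono (Set.image_mono (by simp))) (convexHull_mono (Set.image_mono (by simp))))
  rintro x ⟨hxσ, hxτ⟩
  obtain ⟨a, ha, ha0, ha1, hax⟩ := exists_weights_of_mem_convexHull_image hxσ
  obtain ⟨b, hb, hb0, hb1, hbx⟩ := exists_weights_of_mem_convexHull_image hxτ
  have hab : ∀ i ∈ σ ∪ τ, a i - b i = 0 := by
    refine eq_zero_of_disjoint_convexHull hp ?_ ?_ (hL σ hσ _ fun i hi => ?_)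
      (hL τ hτ _ fun i hi => ?_)
    · rw [Finset.sum_sub_distrib,
        ← Finset.sum_subset Finset.subset_union_left fun i _ hi => ha0 i hi,
        ← Finset.sum_subset Finset.subset_union_right fun i _ hi => hb0 i hi, ha1, hb1, sub_self]
    · simp only [sub_smul]
      rw [Finset.sum_sub_distrib,
        ← Finset.sum_subset Finset.subset_union_left fun i _ hi =>
          show a i • p i = 0 by simp [ha0 i hi],
        ← Finset.sum_subset Finset.subset_union_right fun i _ hi =>
          show b i • p i = 0 by simp [hb0 i hi], hax, hbx, sub_self]
    · by_contra hi'
      have := (Finset.mem_filter.1 hi).2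
      linarith [ha0 i hi', hb i]
    · by_contra hi'
      have := (Finset.mem_filter.1 hi).2
      linarith [hb0 i hi', ha i]
  have hzero : ∀ i ∈ σ, i ∉ σ ∩ τ → a i = 0 := by
    intro i hi hi'
    have hiτ : i ∉ τ := fun h => hi' (Finset.mem_inter.2 ⟨hi, h⟩)
    linarith [hab i (Finset.mem_union_left _ hi), hb0 i hiτ]
  rw [← Finset.sum_subset Finset.inter_subset_left hzero] at ha1
  rw [← Finset.sum_subset Finset.inter_subset_left fun i hi hi' => by
    simp [hzero i hi hi']] at hax
  rw [← hax]
  exact (convex_convexHull ℝ _).sum_mem (fun i _ => ha i) ha1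
    fun i hi => subset_convexHull ℝ _ (Set.mem_image_of_mem p hi)

/-- A representation of the nerve of the nonempty faces of `L` by convex sets yields a map from the
vertices such that disjoint faces have images with disjoint convex hulls. -/
theorem exists_disjoint_convexHull_of_representable {V : Type*} [DecidableEq V] {d : ℕ}
    {L : Finset (Finset V)} (hrep : Representable d (nerveFaces L)) :
    ∃ p : V → (Fin d → ℝ), ∀ σ ∈ L, ∀ τ ∈ L, Disjoint σ τ →
      Disjoint (convexHull ℝ (p '' (σ : Set V))) (convexHull ℝ (p '' (τ : Set V))) := by
  obtain ⟨C, hC, hnerve⟩ := hrep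
  have hstar (v : V) : ∃ x, ∀ σ ∈ L, v ∈ σ → x ∈ C σ := by
    obtain ⟨x, hx⟩ := (hnerve {σ ∈ L | v ∈ σ}).1 (by
      simp only [nerveFaces, Finset.mem_filter, Finset.mem_powerset]
      refine ⟨fun σ hσ => ?_, v, fun σ hσ => hσ.2⟩
      simp only [Finset.mem_filter] at hσ ⊢
      exact ⟨hσ.1, v, hσ.2⟩)
    exact ⟨x, fun σ hσ hv => hx σ (by simp [hσ, hv])⟩
  choose p hp using hstar
  have hsub : ∀ σ ∈ L, convexHull ℝ (p '' (σ : Set V)) ⊆ C σ := fun σ hσ =>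
    convexHull_min (Set.image_subset_iff.2 fun v hv => hp v σ hσ hv) (hC σ)
  refine ⟨p, fun σ hσ τ hτ hdisj => Set.disjoint_left.2 fun x hxσ hxτ => ?_⟩
  have hmem : {σ, τ} ∈ nerveFaces L := (hnerve {σ, τ}).2
    ⟨x, by simpa using ⟨hsub σ hσ hxσ, hsub τ hτ hxτ⟩⟩
  simp only [nerveFaces, Finset.mem_filter] at hmem
  obtain ⟨-, v, hv⟩ := hmem
  exact Finset.disjoint_left.1 hdisj (hv σ (by simp)) (hv τ (by simp))

/-- If the nerve of the family of nonempty faces of a finite simplicial complex `L` is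
`d`-representable, then `L` embeds linearly in `ℝ^d`: there is a map `p` from the
vertices to `ℝ^d` such that each `p(σ)`, `σ ∈ L`, is an affinely independent point set,
and `conv(p(σ)) ∩ conv(p(τ)) = conv(p(σ ∩ τ))` for all faces `σ, τ ∈ L`. -/
theorem embeds_of_nerve_representable (d : ℕ) (L : Finset (Finset ℕ))
    (hL : IsComplex L) (hrep : Representable d (nerveFaces L)) :
    ∃ p : ℕ → (Fin d → ℝ),
      (∀ σ ∈ L, AffineIndependent ℝ ((↑) : (p '' (σ : Set ℕ)) → (Fin d → ℝ))) ∧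
      (∀ σ ∈ L, ∀ τ ∈ L,
        convexHull ℝ (p '' (σ : Set ℕ)) ∩ convexHull ℝ (p '' (τ : Set ℕ)) =
          convexHull ℝ (p '' ((σ ∩ τ : Finset ℕ) : Set ℕ))) := by
  obtain ⟨p, hp⟩ := exists_disjoint_convexHull_of_representable hrep
  exact ⟨p, fun σ hσ => affineIndependent_image_of_disjoint_convexHull hL hp hσ,
    fun σ hσ τ hτ => convexHull_image_inter_of_disjoint_convexHull hL hp hσ hτ⟩
end

section
/- Let F be a finite family of sets, each of cardinality at most d. Then the nerve N(F) is d-collapsible. -/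
open Classical in
/-- The nerve of a finite indexed family of sets: the simplices are the index sets
`σ ⊆ Fin n` whose corresponding sets have a common element. -/
noncomputable def nerveFam {α : Type*} {n : ℕ} (F : Fin n → Finset α) :
    Finset (Finset (Fin n)) :=
  Finset.univ.powerset.filter (fun σ => σ = ∅ ∨ ∃ x, ∀ i ∈ σ, x ∈ F i)

/-- If the faces of `K` containing `σ` are exactly the members of the interval `[σ, τ]`, then
removing this interval is an elementary collapse. -/
theorem ElemCollapse.of_interval {V : Type*} [DecidableEq V] {d : ℕ} {K K' : Finset (Finset V)}
    {σ τ : Finset V} (hd : σ.card ≤ d) (hστ : σ ⊆ τ)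
    (hK : ∀ η, σ ⊆ η → (η ∈ K ↔ η ⊆ τ)) (hK' : ∀ η, η ∈ K' ↔ η ∈ K ∧ ¬ σ ⊆ η) :
    ElemCollapse d K K' := by
  have hτ : τ ∈ K := (hK τ hστ).2 subset_rfl
  refine ⟨σ, τ, (hK σ subset_rfl).2 hστ, hd, ⟨hτ, hστ, fun ρ hρ h => ?_⟩,
    fun τ' hτ' h hmax => ?_, ?_⟩
  · exact ((hK ρ (hστ.trans h)).1 hρ).antisymm h
  · exact (hmax τ hτ ((hK τ' h).1 hτ')).symm
  · ext η
    rw [hK', Finset.mem_filter]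
    refine and_congr_right fun hη => not_congr ⟨fun h => ⟨h, (hK η h).1 hη⟩, And.left⟩

open Classical in
/-- Let `A` consist of indices of sets containing a point `z ∉ Y`. Suppose the faces of `K`
which contain `M` and have no common point in `Y` are exactly the sets in the interval `[M, A]`
with this property. Then these faces can be removed from `K` by elementary `d`-collapses, provided
`M` is small compared to some `F u \ Y` with `u ∈ M`. -/
theorem reflTransGen_elemCollapse_of_interval {α V : Type*} [DecidableEq V] {d : ℕ}
    {F : V → Finset α} (hF : ∀ i, (F i).card ≤ d) {z : α} (K K' : Finset (Finset V))
    (M A : Finset V) (Y : Finset α) (hz : z ∉ Y) (hA : ∀ i ∈ A, z ∈ F i) (hMA : M ⊆ A)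
    (hM : M = ∅ ∨ ∃ u ∈ M, M.card ≤ (F u \ Y).card)
    (hK : ∀ η, M ⊆ η → (∀ x ∈ Y, ∃ i ∈ η, x ∉ F i) → (η ∈ K ↔ η ⊆ A))
    (hK' : ∀ η, η ∈ K' ↔ η ∈ K ∧ ¬ (M ⊆ η ∧ ∀ x ∈ Y, ∃ i ∈ η, x ∉ F i)) :
    Relation.ReflTransGen (ElemCollapse d) K K' := by
  induction hm : Y.card + A.card using Nat.strong_induction_on generalizing K K' M A Y with
  | _ m ih =>
  subst hm
  obtain rfl | ⟨x, hx⟩ := Y.eq_empty_or_nonempty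
  · refine .single (ElemCollapse.of_interval ?_ hMA (fun η h => hK η h (by simp)) (by simpa using hK'))
    obtain rfl | ⟨u, -, hu⟩ := hM
    · simp
    · exact hu.trans ((Finset.card_le_card Finset.sdiff_subset).trans (hF u))
  have hcard : (Y.erase x).card < Y.card := Finset.card_erase_lt_of_mem hx
  have herase : ∀ η : Finset V, (∃ i ∈ η, x ∉ F i) →
      ((∀ y ∈ Y.erase x, ∃ i ∈ η, y ∉ F i) ↔ ∀ y ∈ Y, ∃ i ∈ η, y ∉ F i) := by
    intro η hη
    refine ⟨fun h y hy => ?_, fun h y hy => h y (Finset.mem_of_mem_erase hy)⟩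
    by_cases hyx : y = x
    · rwa [hyx]
    · exact h y (Finset.mem_erase.2 ⟨hyx, hy⟩)
  have hz' : z ∉ Y.erase x := fun h => hz (Finset.mem_of_mem_erase h)
  by_cases hMx : ∃ i ∈ M, x ∉ F i
  · have hex : ∀ η, M ⊆ η → ∃ i ∈ η, x ∉ F i := fun η h =>
      hMx.imp fun i hi => ⟨h hi.1, hi.2⟩
    refine ih _ (by omega) K K' M A (Y.erase x) hz' hA hMA ?_
      (fun η h h' => hK η h ((herase η (hex η h)).1 h')) (fun η => ?_) rfl
    · refine hM.imp_right fun ⟨u, hu, h⟩ => ⟨u, hu, h.trans (Finset.card_le_card ?_)⟩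
      exact Finset.sdiff_subset_sdiff subset_rfl (Finset.erase_subset _ _)
    · rw [hK']
      exact and_congr_right fun _ => not_congr (and_congr_right fun h => (herase η (hex η h)).symm)
  push Not at hMx
  by_cases hAx : ∀ i ∈ A, x ∈ F i
  · have : K' = K := by
      ext η
      rw [hK', and_iff_left_iff_imp]
      rintro hη ⟨h, h'⟩
      obtain ⟨i, hi, hxi⟩ := h' x hx
      exact hxi (hAx i ((hK η h h').1 hη hi))
    rw [this]
  push Not at hAx
  obtain ⟨v, hvA, hv⟩ := hAx
  have hvM : v ∉ M := fun h => hv (hMx v h)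
  have hAcard : (A.erase v).card < A.card := Finset.card_erase_lt_of_mem hvA
  have hex : ∀ η, insert v M ⊆ η → ∃ i ∈ η, x ∉ F i := fun η h =>
    ⟨v, h (Finset.mem_insert_self v M), hv⟩
  set K₁ := K.filter fun η => ¬ (insert v M ⊆ η ∧ ∀ y ∈ Y, ∃ i ∈ η, y ∉ F i) with hK₁
  refine Relation.ReflTransGen.trans (b := K₁) ?_ ?_
  · refine ih _ (by omega) K K₁ (insert v M) A (Y.erase x) hz' hA
      (Finset.insert_subset hvA hMA) (.inr ?_)
      (fun η h h' => hK η ((Finset.subset_insert _ _).trans h) ((herase η (hex η h)).1 h'))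
      (fun η => ?_) rfl
    · rw [Finset.card_insert_of_notMem hvM]
      obtain rfl | ⟨u, hu, h⟩ := hM
      · refine ⟨v, Finset.mem_insert_self _ _, ?_⟩
        rw [Finset.card_empty, zero_add, Nat.one_le_iff_ne_zero, Finset.card_ne_zero]
        exact ⟨z, Finset.mem_sdiff.2 ⟨hA v hvA, hz'⟩⟩
      · refine ⟨u, Finset.mem_insert_of_mem hu, Nat.succ_le_of_lt (h.trans_lt ?_)⟩
        refine Finset.card_lt_card (Finset.ssubset_iff_of_subset
          (Finset.sdiff_subset_sdiff subset_rfl (Finset.erase_subset _ _)) |>.2 ⟨x, ?_, ?_⟩)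
        · simp [hMx u hu]
        · simp [hx]
    · rw [hK₁, Finset.mem_filter]
      exact and_congr_right fun _ => not_congr (and_congr_right fun h => (herase η (hex η h)).symm)
  · refine ih _ (by omega) K₁ K' M (A.erase v) Y hz (fun i hi => hA i (Finset.mem_of_mem_erase hi))
      (Finset.subset_erase.2 ⟨hMA, hvM⟩) hM (fun η h h' => ?_) (fun η => ?_) rfl
    · rw [hK₁, Finset.mem_filter, hK η h h', Finset.subset_erase, Finset.insert_subset_iff]
      tauto
    · rw [hK', hK₁, Finset.mem_filter, Finset.insert_subset_iff]
      tauto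

open Classical in
/-- The sets of indices whose members share a point of `Y` form a `d`-collapsible complex. -/
theorem collapsible_filter_common_point {α V : Type*} [Fintype V] [DecidableEq V] {d : ℕ}
    {F : V → Finset α} (hF : ∀ i, (F i).card ≤ d) (Y : Finset α) :
    Collapsible d
      (Finset.univ.filter fun σ : Finset V => ∃ x ∈ Y, ∀ i ∈ σ, x ∈ F i) := by
  induction Y using Finset.induction_on with
  | empty =>
    simp only [Finset.notMem_empty, false_and, exists_false, Finset.filter_false]
    exact Relation.ReflTransGen.refl
  | insert z Y hz ih =>
    refine Relation.ReflTransGen.trans ?_ ih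
    refine reflTransGen_elemCollapse_of_interval hF (z := z) _ _ ∅
      (Finset.univ.filter fun i => z ∈ F i) Y hz (by simp) (by simp) (.inl rfl)
      (fun η _ h => ?_) (fun η => ?_)
    · have : ¬ ∃ x ∈ Y, ∀ i ∈ η, x ∈ F i := by push Not; exact h
      simp only [Finset.mem_filter, Finset.mem_univ, true_and, Finset.exists_mem_insert, this,
        or_false, Finset.subset_iff]
    · simp only [Finset.mem_filter, Finset.mem_univ, true_and, Finset.exists_mem_insert,
        Finset.empty_subset]
      push Not
      tauto

/-- The nerve of a finite family of sets, each of size at most `d`, is `d`-collapsible. -/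
theorem nerve_collapsible_of_small_sets {α : Type*} (d n : ℕ) (F : Fin n → Finset α)
    (hF : ∀ i, (F i).card ≤ d) :
    Collapsible d (nerveFam F) := by
  classical
  by_cases hU : Finset.univ.biUnion F = ∅
  · have hempty : ∀ i x, x ∉ F i := fun i x hx =>
      Finset.notMem_empty x (hU ▸ Finset.mem_biUnion.2 ⟨i, Finset.mem_univ i, hx⟩)
    have hmem : ∀ η, η ∈ nerveFam F ↔ η = ∅ := by
      intro η
      simp only [nerveFam, Finset.mem_filter, Finset.mem_powerset, Finset.subset_univ, true_and,
        hempty, or_iff_left_iff_imp, Finset.eq_empty_iff_forall_notMem]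
      exact fun ⟨_, h⟩ => h
    exact .single (ElemCollapse.of_interval (σ := ∅) (τ := ∅) (by simp) subset_rfl
      (fun η _ => by rw [hmem, Finset.subset_empty]) (by simp))
  · obtain ⟨z, hz⟩ := Finset.nonempty_iff_ne_empty.2 hU
    convert collapsible_filter_common_point hF (Finset.univ.biUnion F) using 1
    ext η
    simp only [nerveFam, Finset.mem_filter, Finset.mem_powerset, Finset.subset_univ,
      Finset.mem_univ, true_and]
    constructor
    · rintro (rfl | ⟨x, hx⟩)
      · exact ⟨z, hz, by simp⟩
      · obtain rfl | ⟨i, hi⟩ := η.eq_empty_or_nonempty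
        · exact ⟨z, hz, by simp⟩
        · exact ⟨x, Finset.mem_biUnion.2 ⟨i, Finset.mem_univ i, hx i hi⟩, hx⟩
    · rintro ⟨x, -, hx⟩
      exact .inr ⟨x, hx⟩
end

section
/- Let A and B be finite subsets of ℝ^d, and suppose there is a point x ∈ (conv(A) ∩ conv(B)) \ conv(A ∩ B). Then there exist disjoint affinely independent subsets A' ⊆ A and B' ⊆ B such that conv(A') ∩ conv(B') ≠ ∅. -/
open Finset in
/-- A sum whose terms vanish wherever `w` does splits along the sign of `w`. -/
theorem sum_filter_pos_add_sum_filter_neg {ι R M : Type*} [Zero R] [LinearOrder R]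
    [AddCommMonoid M] {s : Finset ι} (w : ι → R) {f : ι → M} (hf : ∀ i, w i = 0 → f i = 0) :
    ∑ i ∈ s with 0 < w i, f i + ∑ i ∈ s with w i < 0, f i = ∑ i ∈ s, f i := by
  rw [← sum_filter_add_sum_filter_not s (fun i ↦ 0 < w i) f]
  congr 1
  refine sum_subset (fun i hi ↦ ?_) fun i hi hin ↦ hf i ?_
  · simp only [mem_filter] at hi ⊢
    exact ⟨hi.1, hi.2.not_gt⟩
  · simp only [mem_filter] at hi hin
    exact le_antisymm (not_lt.1 hi.2) (not_lt.1 fun h ↦ hin ⟨hi.1, h⟩)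

open Finset in
/-- If a point lies in the convex hulls of two finite sets but not in the convex hull of their
intersection, then the two sets have disjoint subsets whose convex hulls intersect. -/
theorem exists_disjoint_subset_convexHull_inter_nonempty {𝕜 E : Type*} [Field 𝕜] [LinearOrder 𝕜]
    [IsStrictOrderedRing 𝕜] [AddCommGroup E] [Module 𝕜 E] [DecidableEq E] {s t : Finset E} {x : E}
    (hs : x ∈ convexHull 𝕜 (s : Set E)) (ht : x ∈ convexHull 𝕜 (t : Set E))
    (hst : x ∉ convexHull 𝕜 ((s : Set E) ∩ t)) :
    ∃ p ⊆ s, ∃ q ⊆ t, Disjoint p q ∧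
      (convexHull 𝕜 (p : Set E) ∩ convexHull 𝕜 (q : Set E)).Nonempty := by
  obtain ⟨a, ha₀, ha₁, hax⟩ := Finset.mem_convexHull'.1 hs
  obtain ⟨b, hb₀, hb₁, hbx⟩ := Finset.mem_convexHull'.1 ht
  let w (y : E) : 𝕜 := (if y ∈ s then a y else 0) - if y ∈ t then b y else 0
  have hw_sum : ∑ y ∈ s ∪ t, w y = 0 := by
    simp [w, ha₁, hb₁, Finset.inter_eq_right.2]
  have hw_smul : ∑ y ∈ s ∪ t, w y • y = 0 := by
    simp [w, sub_smul, ite_smul, hax, hbx, Finset.inter_eq_right.2]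
  have hw_ne : ∃ y ∈ s ∪ t, w y ≠ 0 := by
    by_contra! hw
    have ha_zero : ∀ y ∈ s, y ∉ s ∩ t → a y = 0 := by
      intro y hy hyst
      have hyt : y ∉ t := fun h ↦ hyst (mem_inter.2 ⟨hy, h⟩)
      simpa [w, hy, hyt] using hw y (mem_union_left _ hy)
    refine hst ?_
    rw [← coe_inter, Finset.mem_convexHull']
    refine ⟨a, fun y hy ↦ ha₀ y (mem_inter.1 hy).1, ?_, ?_⟩
    · rwa [sum_subset inter_subset_left ha_zero]
    · rwa [sum_subset inter_subset_left fun y hy hyt ↦ by rw [ha_zero y hy hyt, zero_smul]]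
  let p : Finset E := {y ∈ s ∪ t | 0 < w y}
  let q : Finset E := {y ∈ s ∪ t | w y < 0}
  have hpq : ∑ y ∈ p, w y + ∑ y ∈ q, w y = 0 :=
    (sum_filter_pos_add_sum_filter_neg w fun _ h ↦ h).trans hw_sum
  have hp : 0 < ∑ y ∈ p, w y := by
    obtain ⟨y, hy, hwy⟩ := exists_pos_of_sum_zero_of_exists_nonzero _ hw_sum hw_ne
    exact sum_pos (fun _ h ↦ (mem_filter.1 h).2) ⟨y, mem_filter.2 ⟨hy, hwy⟩⟩
  have hcenter : p.centerMass w id = q.centerMass w id :=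
    centerMass_of_sum_add_sum_eq_zero hpq <|
      (sum_filter_pos_add_sum_filter_neg w (f := fun y ↦ w y • y)
        fun y h ↦ by rw [h, zero_smul]).trans hw_smul
  refine ⟨p, fun y hy ↦ ?_, q, fun y hy ↦ ?_, ?_, p.centerMass w id, ?_, ?_⟩
  · by_contra hys
    obtain ⟨hyst, hwy⟩ := mem_filter.1 hy
    have hyt : y ∈ t := (mem_union.1 hyst).resolve_left hys
    have := hb₀ y hyt
    simp only [w, hys, hyt, if_true, if_false] at hwy
    linarith
  · by_contra hyt
    obtain ⟨hyst, hwy⟩ := mem_filter.1 hy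
    have hys : y ∈ s := (mem_union.1 hyst).resolve_right hyt
    have := ha₀ y hys
    simp only [w, hys, hyt, if_true, if_false] at hwy
    linarith
  · exact disjoint_filter.2 fun _ _ h ↦ h.not_gt
  · exact p.centerMass_id_mem_convexHull (fun _ h ↦ (mem_filter.1 h).2.le) hp
  · rw [hcenter]
    exact q.centerMass_id_mem_convexHull_of_nonpos (fun _ h ↦ (mem_filter.1 h).2.le)
      (by linarith)

/-- Let `A` and `B` be finite subsets of `ℝ^d` and suppose some point lies in
`conv(A) ∩ conv(B)` but not in `conv(A ∩ B)`. Then there are disjoint affinely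
independent subsets `A' ⊆ A` and `B' ⊆ B` whose convex hulls intersect. -/
theorem radon_type_lemma (d : ℕ) (A B : Set (Fin d → ℝ)) (hA : A.Finite) (hB : B.Finite)
    (x : Fin d → ℝ)
    (hx : x ∈ (convexHull ℝ A ∩ convexHull ℝ B) \ convexHull ℝ (A ∩ B)) :
    ∃ A' B' : Set (Fin d → ℝ), A' ⊆ A ∧ B' ⊆ B ∧ Disjoint A' B' ∧
      AffineIndependent ℝ ((↑) : A' → (Fin d → ℝ)) ∧
      AffineIndependent ℝ ((↑) : B' → (Fin d → ℝ)) ∧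
      (convexHull ℝ A' ∩ convexHull ℝ B').Nonempty := by
  classical
  lift A to Finset (Fin d → ℝ) using hA
  lift B to Finset (Fin d → ℝ) using hB
  obtain ⟨p, hpA, q, hqB, hpq, y, hyp, hyq⟩ :=
    exists_disjoint_subset_convexHull_inter_nonempty hx.1.1 hx.1.2 hx.2
  rw [convexHull_eq_union] at hyp hyq
  simp only [Set.mem_iUnion] at hyp hyq
  obtain ⟨A', hA'p, hA', hyA'⟩ := hyp
  obtain ⟨B', hB'q, hB', hyB'⟩ := hyq
  exact ⟨A', B', hA'p.trans (Finset.coe_subset.2 hpA), hB'q.trans (Finset.coe_subset.2 hqB),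
    (Finset.disjoint_coe.2 hpq).mono hA'p hB'q, hA', hB', y, hyA', hyB'⟩
end

section
/- For every two nonempty finite abstract simplicial complexes K and L (with disjoint vertex sets), the Leray number of the join K * L equals the sum of the Leray numbers of K and L: ldim(K * L) = ldim(K) + ldim(L). -/
section Chains

variable {V : Type*}

/-- The `ℚ`-module of chains of `K` on faces with exactly `n` vertices. -/
def chains (K : Finset (Finset V)) (n : ℕ) : Submodule ℚ (Finset V →₀ ℚ) :=
  Finsupp.supported ℚ ℚ {σ | σ ∈ K ∧ σ.card = n}

theorem isChainOn_iff_mem_chains [DecidableEq V] {K : Finset (Finset V)} {n : ℕ} {c : Finset V →₀ ℚ} :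
    IsChainOn K n c ↔ c ∈ chains K n := by
  rw [chains, Finsupp.mem_supported]
  exact ⟨fun h σ hσ => h σ hσ, fun h σ hσ => h hσ⟩

theorem single_mem_chains {K : Finset (Finset V)} {n : ℕ} {σ : Finset V} (r : ℚ) (hσ : σ ∈ K)
    (hn : σ.card = n) : Finsupp.single σ r ∈ chains K n :=
  Finsupp.single_mem_supported ℚ r ⟨hσ, hn⟩

theorem map_mem_of_chains {N : Type*} [AddCommGroup N] [Module ℚ N] {K : Finset (Finset V)}
    {n : ℕ} {f : (Finset V →₀ ℚ) →ₗ[ℚ] N} {P : Submodule ℚ N}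
    (h : ∀ σ ∈ K, σ.card = n → f (Finsupp.single σ 1) ∈ P) {x : Finset V →₀ ℚ}
    (hx : x ∈ chains K n) : f x ∈ P := by
  rw [chains, Finsupp.supported_eq_span_single] at hx
  induction hx using Submodule.span_induction with
  | mem x hx => obtain ⟨σ, hσ, rfl⟩ := hx; exact h σ hσ.1 hσ.2
  | zero => simp
  | add x y _ _ hx hy => rw [map_add]; exact P.add_mem hx hy
  | smul r x _ hx => rw [map_smul]; exact P.smul_mem r hx

theorem map_eq_of_chains {N : Type*} [AddCommGroup N] [Module ℚ N] {K : Finset (Finset V)}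
    {n : ℕ} {f g : (Finset V →₀ ℚ) →ₗ[ℚ] N}
    (h : ∀ σ ∈ K, σ.card = n → f (Finsupp.single σ 1) = g (Finsupp.single σ 1))
    {x : Finset V →₀ ℚ} (hx : x ∈ chains K n) : f x = g x := by
  have : (f - g) x ∈ (⊥ : Submodule ℚ N) :=
    map_mem_of_chains (fun σ hσ hn => by simp [h σ hσ hn]) hx
  simpa [sub_eq_zero] using this

theorem bilin_eq_of_chains {N : Type*} [AddCommGroup N] [Module ℚ N] {K L : Finset (Finset V)}
    {p q : ℕ} {f g : (Finset V →₀ ℚ) →ₗ[ℚ] (Finset V →₀ ℚ) →ₗ[ℚ] N}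
    (h : ∀ σ ∈ K, σ.card = p → ∀ τ ∈ L, τ.card = q →
      f (Finsupp.single σ 1) (Finsupp.single τ 1) = g (Finsupp.single σ 1) (Finsupp.single τ 1))
    {x y : Finset V →₀ ℚ} (hx : x ∈ chains K p) (hy : y ∈ chains L q) : f x y = g x y :=
  map_eq_of_chains (f := f.flip y) (g := g.flip y)
    (fun σ hσ hp => map_eq_of_chains (f := f (Finsupp.single σ 1)) (h σ hσ hp) hy) hx

/-- The linear map multiplying a face `σ` by `(-1) ^ |σ|`. -/
noncomputable def signMap : (Finset V →₀ ℚ) →ₗ[ℚ] (Finset V →₀ ℚ) :=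
  Finsupp.linearCombination ℚ fun σ => Finsupp.single σ ((-1 : ℚ) ^ σ.card)

theorem signMap_of_mem_chains {K : Finset (Finset V)} {n : ℕ} {x : Finset V →₀ ℚ}
    (hx : x ∈ chains K n) : signMap x = (-1 : ℚ) ^ n • x := by
  refine map_eq_of_chains (f := signMap) (g := (-1 : ℚ) ^ n • LinearMap.id) ?_ hx
  intro σ _ hn
  simp [signMap, hn]

theorem signMap_mem_chains {K : Finset (Finset V)} {n : ℕ} {x : Finset V →₀ ℚ}
    (hx : x ∈ chains K n) : signMap x ∈ chains K n := by
  rw [signMap_of_mem_chains hx]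
  exact Submodule.smul_mem _ _ hx

end Chains

section Boundary

variable {V : Type*} [DecidableEq V] [LinearOrder V]

theorem bdry_single (σ : Finset V) (r : ℚ) :
    bdry (Finsupp.single σ r) =
      ∑ v ∈ σ, Finsupp.single (σ.erase v) (r * (-1 : ℚ) ^ (σ.filter (· < v)).card) := by
  simp [bdry, Finset.smul_sum, -Finsupp.single_mul]

theorem card_filter_lt_erase_of_lt {σ : Finset V} {v w : V} (hv : v ∈ σ) (hvw : v < w) :
    (σ.filter (· < w)).card = ((σ.erase v).filter (· < w)).card + 1 := by
  rw [Finset.filter_erase, Finset.card_erase_add_one]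
  simp [hv, hvw]

theorem card_filter_lt_erase_of_not_lt {σ : Finset V} {v w : V} (hvw : ¬ v < w) :
    ((σ.erase v).filter (· < w)).card = (σ.filter (· < w)).card := by
  rw [Finset.filter_erase, Finset.erase_eq_of_notMem]
  simp [hvw]

theorem bdry_bdry_single (σ : Finset V) : bdry (bdry (Finsupp.single σ 1)) = 0 := by
  rw [bdry_single, map_sum]
  simp_rw [bdry_single]
  rw [Finset.sum_sigma']
  refine Finset.sum_involution (fun p _ => ⟨p.2, p.1⟩) ?_ ?_ ?_ ?_
  · rintro ⟨v, w⟩ h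
    simp only [Finset.mem_sigma, Finset.mem_erase] at h
    obtain ⟨hv, hwv, hw⟩ := h
    dsimp only
    rw [Finset.erase_right_comm, ← Finsupp.single_add, Finsupp.single_eq_zero]
    rcases lt_or_gt_of_ne hwv with hlt | hlt
    · rw [card_filter_lt_erase_of_lt hw hlt, card_filter_lt_erase_of_not_lt hlt.not_gt]
      ring
    · rw [card_filter_lt_erase_of_lt hv hlt, card_filter_lt_erase_of_not_lt hlt.not_gt]
      ring
  · rintro ⟨v, w⟩ h _ heq
    simp only [Finset.mem_sigma, Finset.mem_erase] at h
    exact h.2.1 (congrArg Sigma.fst heq)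
  · rintro ⟨v, w⟩ h
    simp only [Finset.mem_sigma, Finset.mem_erase] at h ⊢
    exact ⟨h.2.2, h.2.1.symm, h.1⟩
  · rintro ⟨v, w⟩ _
    rfl

theorem bdry_bdry (x : Finset V →₀ ℚ) : bdry (bdry x) = 0 := by
  have : (bdry ∘ₗ bdry : (Finset V →₀ ℚ) →ₗ[ℚ] (Finset V →₀ ℚ)) = 0 :=
    Finsupp.lhom_ext' fun σ => LinearMap.ext_ring (by simpa using bdry_bdry_single σ)
  exact LinearMap.congr_fun this x

theorem bdry_mem_chains {K : Finset (Finset V)} (hK : IsComplex K) {n : ℕ} {x : Finset V →₀ ℚ}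
    (hx : x ∈ chains K (n + 1)) : bdry x ∈ chains K n := by
  refine map_mem_of_chains (fun σ hσ hn => ?_) hx
  rw [bdry_single]
  refine Submodule.sum_mem _ fun v hv => single_mem_chains _ (hK σ hσ _ (σ.erase_subset v)) ?_
  rw [Finset.card_erase_of_mem hv, hn, Nat.add_sub_cancel]

theorem bdry_eq_zero_of_mem_chains_zero {K : Finset (Finset V)} {x : Finset V →₀ ℚ}
    (hx : x ∈ chains K 0) : bdry x = 0 := by
  refine map_eq_of_chains (g := 0) (fun σ _ hn => ?_) hx
  rw [Finset.card_eq_zero.mp hn, bdry_single]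
  simp

theorem bdry_mem_chains_pred {K : Finset (Finset V)} (hK : IsComplex K) {n : ℕ}
    {x : Finset V →₀ ℚ} (hx : x ∈ chains K n) : bdry x ∈ chains K (n - 1) := by
  obtain _ | n := n
  · simp [bdry_eq_zero_of_mem_chains_zero hx]
  · exact bdry_mem_chains hK hx

theorem signMap_bdry {K : Finset (Finset V)} (hK : IsComplex K) {n : ℕ}
    {x : Finset V →₀ ℚ} (hx : x ∈ chains K n) : signMap (bdry x) = -((-1 : ℚ) ^ n • bdry x) := by
  obtain _ | n := n
  · simp [bdry_eq_zero_of_mem_chains_zero hx]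
  · rw [signMap_of_mem_chains (bdry_mem_chains hK hx), pow_succ]
    simp

end Boundary

section Homotopy

variable {V : Type*} [DecidableEq V] [LinearOrder V]

theorem exists_generalized_inverse {E F : Type*} [AddCommGroup E] [Module ℚ E] [AddCommGroup F]
    [Module ℚ F] (f : E →ₗ[ℚ] F) : ∃ g : F →ₗ[ℚ] E, ∀ x, f (g (f x)) = f x := by
  obtain ⟨s, hs⟩ := f.rangeRestrict.exists_rightInverse_of_surjective f.range_rangeRestrict
  obtain ⟨g, hg⟩ := s.exists_extend
  refine ⟨g, fun x => ?_⟩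
  have h1 : g (f x) = s (f.rangeRestrict x) := LinearMap.congr_fun hg (f.rangeRestrict x)
  have h2 := congrArg Subtype.val (LinearMap.congr_fun hs (f.rangeRestrict x))
  rw [h1]
  simpa using h2

/-- A graded generalized inverse of the boundary operator of `K`. -/
theorem exists_graded_inverse (K : Finset (Finset V)) (hK : IsComplex K) :
    ∃ s : (Finset V →₀ ℚ) →ₗ[ℚ] (Finset V →₀ ℚ),
      (∀ n, ∀ x ∈ chains K n, s x ∈ chains K (n + 1)) ∧
      ∀ n, ∀ x ∈ chains K (n + 1), bdry (s (bdry x)) = bdry x := by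
  choose g hg using fun n => exists_generalized_inverse (bdry.domRestrict (chains K (n + 1)))
  let s : (Finset V →₀ ℚ) →ₗ[ℚ] (Finset V →₀ ℚ) :=
    Finsupp.linearCombination ℚ fun σ => (g σ.card (Finsupp.single σ 1)).val
  have hs : ∀ n, ∀ x ∈ chains K n, s x = g n x := fun n x hx =>
    map_eq_of_chains (f := s) (g := (chains K (n + 1)).subtype ∘ₗ g n)
      (fun σ _ hn => by subst hn; simp [s]) hx
  refine ⟨s, fun n x hx => ?_, fun n x hx => ?_⟩
  · rw [hs n x hx]
    exact (g n x).2
  · rw [hs n _ (bdry_mem_chains hK hx)]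
    simpa using hg n ⟨x, hx⟩

theorem exists_homotopy {K : Finset (Finset V)} (hK : IsComplex K) {a : ℕ}
    (ha : ∀ k, a ≤ k → HomologyVanishes K k) :
    ∃ h : (Finset V →₀ ℚ) →ₗ[ℚ] (Finset V →₀ ℚ),
      (∀ n, ∀ x ∈ chains K n, h x ∈ chains K (n + 1)) ∧
      ∀ n, a < n → ∀ x ∈ chains K n, bdry (h x) + h (bdry x) = x := by
  obtain ⟨s, hs, hsb⟩ := exists_graded_inverse K hK
  have hsd : ∀ n, ∀ x ∈ chains K n, s (bdry x) ∈ chains K n := by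
    rintro (_ | n) x hx
    · simp [bdry_eq_zero_of_mem_chains_zero hx]
    · exact hs n _ (bdry_mem_chains hK hx)
  refine ⟨s - s ∘ₗ s ∘ₗ bdry, fun n x hx => ?_, fun n hn x hx => ?_⟩
  · exact Submodule.sub_mem _ (hs n x hx) (hs n _ (hsd n x hx))
  · obtain ⟨m, rfl⟩ : ∃ m, n = m + 1 := ⟨n - 1, by omega⟩
    have hz : x - s (bdry x) ∈ chains K (m + 1) := Submodule.sub_mem _ hx (hsd _ x hx)
    obtain ⟨y, hy, hyz⟩ := ha m (by omega) _ (isChainOn_iff_mem_chains.mpr hz)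
      (by rw [map_sub, hsb m x hx, sub_self])
    have key := hsb (m + 1) y (isChainOn_iff_mem_chains.mp hy)
    rw [hyz, map_sub, map_sub] at key
    simp only [LinearMap.sub_apply, LinearMap.comp_apply, bdry_bdry, map_zero, map_sub, sub_zero]
    rw [key]
    abel

end Homotopy

section JoinProduct

variable {V : Type*} [LinearOrder V]

/-- The sign of the shuffle sorting the concatenation of `σ` and `τ`. -/
def shuffleSign (σ τ : Finset V) : ℚ :=
  (-1 : ℚ) ^ ((σ ×ˢ τ).filter fun p => p.2 < p.1).card

theorem shuffleSign_mul_self (σ τ : Finset V) : shuffleSign σ τ * shuffleSign σ τ = 1 := by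
  rw [shuffleSign, ← mul_pow]
  simp

theorem shuffleSign_eq_prod_left (σ τ : Finset V) :
    shuffleSign σ τ = ∏ v ∈ σ, (-1 : ℚ) ^ (τ.filter (· < v)).card := by
  rw [Finset.prod_pow_eq_pow_sum, shuffleSign, Finset.card_filter, Finset.sum_product]
  simp_rw [Finset.card_filter]

theorem shuffleSign_eq_prod_right (σ τ : Finset V) :
    shuffleSign σ τ = ∏ w ∈ τ, (-1 : ℚ) ^ (σ.filter (w < ·)).card := by
  rw [Finset.prod_pow_eq_pow_sum, shuffleSign, Finset.card_filter, Finset.sum_product_right]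
  simp_rw [Finset.card_filter]

variable [DecidableEq V]

/-- The product of chains sending `σ ⊗ τ` to the suitably oriented simplex `σ ∪ τ`. -/
noncomputable def joinMul :
    (Finset V →₀ ℚ) →ₗ[ℚ] (Finset V →₀ ℚ) →ₗ[ℚ] (Finset V →₀ ℚ) :=
  Finsupp.linearCombination ℚ fun σ => Finsupp.linearCombination ℚ fun τ =>
    Finsupp.single (σ ∪ τ) (shuffleSign σ τ)

theorem joinMul_single (σ τ : Finset V) (r s : ℚ) :
    joinMul (Finsupp.single σ r) (Finsupp.single τ s) =
      Finsupp.single (σ ∪ τ) (r * s * shuffleSign σ τ) := by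
  simp [joinMul, mul_assoc, -Finsupp.single_mul]

theorem joinMul_empty (y : Finset V →₀ ℚ) : joinMul (Finsupp.single ∅ 1) y = y := by
  have : joinMul (Finsupp.single (∅ : Finset V) (1 : ℚ)) = LinearMap.id :=
    Finsupp.lhom_ext fun τ s => by simp [joinMul_single, shuffleSign]
  simp [this]

theorem bdry_joinMul_single {σ τ : Finset V} (h : Disjoint σ τ) :
    bdry (joinMul (Finsupp.single σ 1) (Finsupp.single τ 1)) =
      joinMul (bdry (Finsupp.single σ 1)) (Finsupp.single τ 1) +
        joinMul (signMap (Finsupp.single σ 1)) (bdry (Finsupp.single τ 1)) := by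
  have hs : signMap (Finsupp.single σ (1 : ℚ)) = Finsupp.single σ ((-1 : ℚ) ^ σ.card) := by
    simp [signMap]
  rw [hs, joinMul_single]
  simp only [bdry_single, map_sum, LinearMap.sum_apply, joinMul_single]
  rw [Finset.sum_union h]
  congr 1
  · refine Finset.sum_congr rfl fun v hv => ?_
    have hvτ : v ∉ τ := Finset.disjoint_left.mp h hv
    rw [Finset.erase_union_distrib, Finset.erase_eq_of_notMem hvτ]
    congr 1
    rw [Finset.filter_union, Finset.card_union_of_disjoint (h.mono (Finset.filter_subset _ _)
      (Finset.filter_subset _ _)), shuffleSign_eq_prod_left, shuffleSign_eq_prod_left,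
      ← Finset.mul_prod_erase σ _ hv, pow_add]
    have : ((-1 : ℚ) ^ (τ.filter (· < v)).card) * (-1 : ℚ) ^ (τ.filter (· < v)).card = 1 := by
      rw [← mul_pow]; simp
    linear_combination ((-1 : ℚ) ^ (σ.filter (· < v)).card *
      ∏ x ∈ σ.erase v, (-1 : ℚ) ^ (τ.filter (· < x)).card) * this
  · refine Finset.sum_congr rfl fun v hv => ?_
    have hvσ : v ∉ σ := Finset.disjoint_right.mp h hv
    rw [Finset.erase_union_distrib, Finset.erase_eq_of_notMem hvσ]
    congr 1
    have hc : σ.card = (σ.filter (· < v)).card + (σ.filter (v < ·)).card := by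
      rw [← Finset.card_filter_add_card_filter_not (s := σ) (· < v)]
      congr 2
      refine Finset.filter_congr fun x hx => ?_
      have : x ≠ v := fun e => hvσ (e ▸ hx)
      rw [not_lt, le_iff_lt_or_eq]
      exact ⟨fun h => h.resolve_right this.symm, Or.inl⟩
    rw [Finset.filter_union, Finset.card_union_of_disjoint (h.mono (Finset.filter_subset _ _)
      (Finset.filter_subset _ _)), shuffleSign_eq_prod_right, shuffleSign_eq_prod_right,
      ← Finset.mul_prod_erase τ _ hv, hc, pow_add, pow_add]
    ring

theorem bdry_joinMul {K L : Finset (Finset V)} (hd : ∀ σ ∈ K, ∀ τ ∈ L, Disjoint σ τ) {p q : ℕ}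
    {x y : Finset V →₀ ℚ} (hx : x ∈ chains K p) (hy : y ∈ chains L q) :
    bdry (joinMul x y) = joinMul (bdry x) y + (-1 : ℚ) ^ p • joinMul x (bdry y) := by
  have := bilin_eq_of_chains (f := joinMul.compr₂ bdry)
    (g := joinMul ∘ₗ bdry + (joinMul ∘ₗ signMap).compl₂ bdry)
    (fun σ hσ _ τ hτ _ => by simpa using bdry_joinMul_single (hd σ hσ τ hτ)) hx hy
  simpa [signMap_of_mem_chains hx] using this

theorem joinMul_mem_chains {K L : Finset (Finset V)} (hd : ∀ σ ∈ K, ∀ τ ∈ L, Disjoint σ τ)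
    {p q : ℕ} {x y : Finset V →₀ ℚ} (hx : x ∈ chains K p) (hy : y ∈ chains L q) :
    joinMul x y ∈ chains (Join K L) (p + q) := by
  refine map_mem_of_chains (f := joinMul.flip y) (fun σ hσ hp => ?_) hx
  refine map_mem_of_chains (f := joinMul (Finsupp.single σ 1)) (fun τ hτ hq => ?_) hy
  rw [joinMul_single]
  refine single_mem_chains _ (Finset.mem_image.mpr ⟨(σ, τ), Finset.mk_mem_product hσ hτ, rfl⟩) ?_
  rw [Finset.card_union_of_disjoint (hd σ hσ τ hτ), hp, hq]

theorem map_mem_of_join_chains {N : Type*} [AddCommGroup N] [Module ℚ N]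
    {K L : Finset (Finset V)} (hd : ∀ σ ∈ K, ∀ τ ∈ L, Disjoint σ τ) {n : ℕ}
    {f : (Finset V →₀ ℚ) →ₗ[ℚ] N} {P : Submodule ℚ N}
    (h : ∀ p q, p + q = n → ∀ x ∈ chains K p, ∀ y ∈ chains L q, f (joinMul x y) ∈ P)
    {e : Finset V →₀ ℚ} (he : e ∈ chains (Join K L) n) : f e ∈ P := by
  refine map_mem_of_chains (fun ρ hρ hn => ?_) he
  obtain ⟨⟨σ, τ⟩, hστ, rfl⟩ := Finset.mem_image.mp hρ
  obtain ⟨hσ, hτ⟩ := Finset.mem_product.mp hστ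
  have hsum : σ.card + τ.card = n := by rw [← Finset.card_union_of_disjoint (hd σ hσ τ hτ), hn]
  have key := P.smul_mem (shuffleSign σ τ) (h _ _ hsum _ (single_mem_chains 1 hσ rfl) _
    (single_mem_chains 1 hτ rfl))
  rwa [← map_smul, joinMul_single, Finsupp.smul_single, smul_eq_mul, one_mul, one_mul,
    shuffleSign_mul_self] at key

theorem map_eq_of_join_chains {N : Type*} [AddCommGroup N] [Module ℚ N]
    {K L : Finset (Finset V)} (hd : ∀ σ ∈ K, ∀ τ ∈ L, Disjoint σ τ) {n : ℕ}
    {f g : (Finset V →₀ ℚ) →ₗ[ℚ] N}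
    (h : ∀ p q, p + q = n → ∀ x ∈ chains K p, ∀ y ∈ chains L q,
      f (joinMul x y) = g (joinMul x y))
    {e : Finset V →₀ ℚ} (he : e ∈ chains (Join K L) n) : f e = g e := by
  have : (f - g) e ∈ (⊥ : Submodule ℚ N) :=
    map_mem_of_join_chains hd (fun p q hpq x hx y hy => by simp [h p q hpq x hx y hy]) he
  simpa [sub_eq_zero] using this

/-- The tensor product of `f` and `g`, acting on chains of a join of a complex on vertices in `A`
with a complex on vertices outside `A`. -/
noncomputable def joinMap (A : Finset V) (f g : (Finset V →₀ ℚ) →ₗ[ℚ] (Finset V →₀ ℚ)) :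
    (Finset V →₀ ℚ) →ₗ[ℚ] (Finset V →₀ ℚ) :=
  Finsupp.linearCombination ℚ fun ρ => shuffleSign (ρ ∩ A) (ρ \ A) •
    joinMul (f (Finsupp.single (ρ ∩ A) 1)) (g (Finsupp.single (ρ \ A) 1))

theorem joinMap_joinMul {A : Finset V} {K L : Finset (Finset V)} (hKA : ∀ σ ∈ K, σ ⊆ A)
    (hLA : ∀ τ ∈ L, Disjoint A τ) (f g : (Finset V →₀ ℚ) →ₗ[ℚ] (Finset V →₀ ℚ)) {p q : ℕ}
    {x y : Finset V →₀ ℚ} (hx : x ∈ chains K p) (hy : y ∈ chains L q) :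
    joinMap A f g (joinMul x y) = joinMul (f x) (g y) := by
  have key : ∀ σ ∈ K, σ.card = p → ∀ τ ∈ L, τ.card = q →
      joinMul.compr₂ (joinMap A f g) (Finsupp.single σ 1) (Finsupp.single τ 1) =
        (joinMul ∘ₗ f).compl₂ g (Finsupp.single σ 1) (Finsupp.single τ 1) := by
    intro σ hσ _ τ hτ _
    have h1 : (σ ∪ τ) ∩ A = σ := by
      rw [Finset.union_inter_distrib_right, Finset.inter_eq_left.mpr (hKA σ hσ),
        Finset.disjoint_iff_inter_eq_empty.mp (hLA τ hτ).symm, Finset.union_empty]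
    have h2 : (σ ∪ τ) \ A = τ := by
      rw [Finset.union_sdiff_distrib, Finset.sdiff_eq_empty_iff_subset.mpr (hKA σ hσ),
        Finset.sdiff_eq_self_of_disjoint (hLA τ hτ).symm, Finset.empty_union]
    rw [LinearMap.compr₂_apply, LinearMap.compl₂_apply, LinearMap.comp_apply, joinMul_single, joinMap,
      Finsupp.linearCombination_single, h1, h2, one_mul, one_mul, smul_smul,
      shuffleSign_mul_self, one_smul]
  have := bilin_eq_of_chains key hx hy
  rwa [LinearMap.compr₂_apply, LinearMap.compl₂_apply, LinearMap.comp_apply] at this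

end JoinProduct

section Kunneth

variable {V : Type*} [DecidableEq V] [LinearOrder V]

theorem homologyVanishes_join {A : Finset V} {K L : Finset (Finset V)} (hK : IsComplex K)
    (hL : IsComplex L) (hKA : ∀ σ ∈ K, σ ⊆ A) (hLA : ∀ τ ∈ L, Disjoint A τ) {a b : ℕ}
    (ha : ∀ k, a ≤ k → HomologyVanishes K k) (hb : ∀ k, b ≤ k → HomologyVanishes L k)
    {k : ℕ} (hk : a + b ≤ k) : HomologyVanishes (Join K L) k := by
  have hd : ∀ σ ∈ K, ∀ τ ∈ L, Disjoint σ τ := fun σ hσ τ hτ => (hLA τ hτ).mono_left (hKA σ hσ)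
  obtain ⟨h, hh, hha⟩ := exists_homotopy hK ha
  obtain ⟨h', hh', hhb⟩ := exists_homotopy hL hb
  obtain ⟨r, hr⟩ : ∃ r : (Finset V →₀ ℚ) →ₗ[ℚ] (Finset V →₀ ℚ),
    r = LinearMap.id - bdry ∘ₗ h - h ∘ₗ bdry := ⟨_, rfl⟩
  have hr_apply : ∀ x, r x = x - bdry (h x) - h (bdry x) := fun x => by rw [hr]; rfl
  have hr_mem : ∀ p, ∀ x ∈ chains K p, r x ∈ chains K p := by
    intro p x hx
    rw [hr_apply]
    refine Submodule.sub_mem _ (Submodule.sub_mem _ hx (bdry_mem_chains hK (hh p x hx))) ?_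
    obtain _ | p := p
    · simp [bdry_eq_zero_of_mem_chains_zero hx]
    · exact hh p _ (bdry_mem_chains hK hx)
  have hr_bdry : ∀ x, r (bdry x) = bdry (r x) := fun x => by
    simp [hr_apply, bdry_bdry]
  let H := joinMap A h LinearMap.id + joinMap A (signMap ∘ₗ r) h'
  have hH : ∀ p q, ∀ x ∈ chains K p, ∀ y ∈ chains L q,
      H (joinMul x y) = joinMul (h x) y + joinMul (signMap (r x)) (h' y) := by
    intro p q x hx y hy
    simp only [H, LinearMap.add_apply, joinMap_joinMul hKA hLA _ _ hx hy]
    rfl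
  have hH_mem : ∀ n, ∀ e ∈ chains (Join K L) n, H e ∈ chains (Join K L) (n + 1) := by
    intro n e he
    refine map_mem_of_join_chains hd (fun p q hpq x hx y hy => ?_) he
    rw [hH p q x hx y hy, ← hpq]
    refine Submodule.add_mem _ ?_ ?_
    · rw [add_right_comm]
      exact joinMul_mem_chains hd (hh p x hx) hy
    · rw [add_assoc]
      exact joinMul_mem_chains hd (signMap_mem_chains (hr_mem p x hx)) (hh' q y hy)
  have key : ∀ n, a + b < n → ∀ e ∈ chains (Join K L) n, bdry (H e) + H (bdry e) = e := by
    intro n hn e he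
    refine map_eq_of_join_chains hd (f := bdry ∘ₗ H + H ∘ₗ bdry) (g := LinearMap.id)
      (fun p q hpq x hx y hy => ?_) he
    have hx' := hr_mem p x hx
    simp only [LinearMap.add_apply, LinearMap.comp_apply, LinearMap.id_apply]
    rw [hH p q x hx y hy, bdry_joinMul hd hx hy, map_add, map_add, map_smul,
      hH _ q _ (bdry_mem_chains_pred hK hx) y hy, hH p _ x hx _ (bdry_mem_chains_pred hL hy),
      bdry_joinMul hd (hh p x hx) hy, signMap_of_mem_chains hx', map_smul, LinearMap.smul_apply,
      map_smul, bdry_joinMul hd hx' (hh' q y hy), hr_bdry, signMap_bdry hK hx', map_neg,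
      LinearMap.neg_apply, map_smul, LinearMap.smul_apply, LinearMap.smul_apply, pow_succ]
    have hsq : (-1 : ℚ) ^ p * (-1 : ℚ) ^ p = 1 := by rw [← mul_pow]; simp
    have hgoal : joinMul (bdry (h x) + h (bdry x)) y +
        joinMul (r x) (bdry (h' y) + h' (bdry y)) = joinMul x y := by
      by_cases hp : a < p
      · rw [hha p hp x hx, hr_apply, sub_sub, hha p hp x hx]
        simp
      · rw [hhb q (by omega) y hy, ← LinearMap.add_apply, ← map_add, hr_apply]
        congr 2
        abel
    rw [← hgoal]
    simp only [map_add, LinearMap.add_apply, smul_add, smul_smul, hsq, one_smul, mul_neg, mul_one,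
      neg_smul]
    abel
  intro c hc hc0
  rw [isChainOn_iff_mem_chains] at hc
  refine ⟨H c, isChainOn_iff_mem_chains.mpr (hH_mem _ c hc), ?_⟩
  simpa [hc0] using key (k + 1) (by omega) c hc

theorem exists_cocycle {K : Finset (Finset V)} (hK : IsComplex K) {a : ℕ} {z : Finset V →₀ ℚ}
    (hz : z ∈ chains K a) (hzb : ∀ u ∈ chains K (a + 1), bdry u ≠ z) :
    ∃ φ : (Finset V →₀ ℚ) →ₗ[ℚ] ℚ, φ z = 1 ∧
      (∀ n, n ≠ a → ∀ x ∈ chains K n, φ x = 0) ∧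
      ∀ n, ∀ x ∈ chains K n, φ (bdry x) = 0 := by
  have hz' : z ∉ (chains K (a + 1)).map bdry := by
    rintro ⟨u, hu, hu'⟩
    exact hzb u hu hu'
  obtain ⟨ψ, hψ, hψB⟩ := Submodule.exists_le_ker_of_notMem hz'
  let P : (Finset V →₀ ℚ) →ₗ[ℚ] (Finset V →₀ ℚ) :=
    Finsupp.linearCombination ℚ fun σ => if σ.card = a then Finsupp.single σ 1 else 0
  have hP : ∀ x ∈ chains K a, P x = x := fun x hx =>
    map_eq_of_chains (f := P) (g := LinearMap.id) (fun σ _ hn => by simp [P, hn]) hx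
  have hP' : ∀ n, n ≠ a → ∀ x ∈ chains K n, P x = 0 := fun n hn x hx =>
    map_eq_of_chains (f := P) (g := 0) (fun σ _ h => by simp [P, h, hn]) hx
  have hφ : ∀ n, n ≠ a → ∀ x ∈ chains K n, ((ψ z)⁻¹ • ψ ∘ₗ P) x = 0 := fun n hn x hx => by
    simp [hP' n hn x hx]
  refine ⟨(ψ z)⁻¹ • ψ ∘ₗ P, by simp [hP z hz, hψ], hφ, fun n x hx => ?_⟩
  by_cases hn : n = a + 1
  · subst hn
    have : ψ (bdry x) = 0 := hψB ⟨x, hx, rfl⟩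
    simp [hP _ (bdry_mem_chains hK hx), this]
  · obtain _ | n := n
    · simp [bdry_eq_zero_of_mem_chains_zero hx]
    · exact hφ n (by omega) _ (bdry_mem_chains hK hx)

theorem bdry_ne_joinMul {A : Finset V} {K L : Finset (Finset V)} (hK : IsComplex K)
    (hL : IsComplex L) (hKA : ∀ σ ∈ K, σ ⊆ A) (hLA : ∀ τ ∈ L, Disjoint A τ) {a b : ℕ}
    {z w : Finset V →₀ ℚ} (hz : z ∈ chains K a) (hzb : ∀ u ∈ chains K (a + 1), bdry u ≠ z)
    (hw : w ∈ chains L b) (hwb : ∀ u ∈ chains L (b + 1), bdry u ≠ w) :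
    ∀ e ∈ chains (Join K L) (a + b + 1), bdry e ≠ joinMul z w := by
  intro e he heq
  have hd : ∀ σ ∈ K, ∀ τ ∈ L, Disjoint σ τ := fun σ hσ τ hτ => (hLA τ hτ).mono_left (hKA σ hσ)
  obtain ⟨φ, hφz, hφn, hφb⟩ := exists_cocycle hK hz hzb
  let F := joinMap A (LinearMap.toSpanSingleton ℚ _ (Finsupp.single ∅ 1) ∘ₗ φ) LinearMap.id
  have hF : ∀ p q, ∀ x ∈ chains K p, ∀ y ∈ chains L q, F (joinMul x y) = φ x • y := by
    intro p q x hx y hy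
    simp only [F, joinMap_joinMul hKA hLA _ _ hx hy, LinearMap.comp_apply,
      LinearMap.toSpanSingleton_apply, map_smul, LinearMap.smul_apply, joinMul_empty,
      LinearMap.id_apply]
  have hFmem : F e ∈ chains L (b + 1) := by
    refine map_mem_of_join_chains hd (fun p q hpq x hx y hy => ?_) he
    rw [hF p q x hx y hy]
    by_cases hp : p = a
    · obtain rfl : q = b + 1 := by omega
      exact Submodule.smul_mem _ _ hy
    · simp [hφn p hp x hx]
  have hFb : F (bdry e) = (-1 : ℚ) ^ a • bdry (F e) := by
    refine map_eq_of_join_chains hd (f := F ∘ₗ bdry) (g := (-1 : ℚ) ^ a • bdry ∘ₗ F)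
      (fun p q hpq x hx y hy => ?_) he
    simp only [LinearMap.smul_apply, LinearMap.comp_apply]
    rw [bdry_joinMul hd hx hy, map_add, map_smul, hF _ q _ (bdry_mem_chains_pred hK hx) y hy,
      hF p _ x hx _ (bdry_mem_chains_pred hL hy), hF p q x hx y hy, hφb p x hx]
    by_cases hp : p = a
    · simp [hp]
    · simp [hφn p hp x hx]
  refine hwb ((-1 : ℚ) ^ a • F e) (Submodule.smul_mem _ _ hFmem) ?_
  rw [map_smul, ← hFb, heq, hF a b z hz w hw, hφz, one_smul]

end Kunneth

section Leray

variable {V : Type*} [DecidableEq V]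

theorem IsComplex.inducedSub {K : Finset (Finset V)} (hK : IsComplex K) (X : Finset V) :
    IsComplex (InducedSub K X) := by
  intro σ hσ τ hτ
  obtain ⟨ρ, hρ, rfl⟩ := Finset.mem_image.mp hσ
  refine Finset.mem_image.mpr ⟨τ, hK ρ hρ τ (hτ.trans Finset.inter_subset_left), ?_⟩
  exact Finset.inter_eq_left.mpr (hτ.trans Finset.inter_subset_right)

theorem inducedSub_join (K L : Finset (Finset V)) (X : Finset V) :
    InducedSub (Join K L) X = Join (InducedSub K X) (InducedSub L X) := by
  ext ρ
  simp only [InducedSub, Join, Finset.mem_image, Finset.mem_product, Prod.exists]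
  constructor
  · rintro ⟨_, ⟨σ, τ, ⟨hσ, hτ⟩, rfl⟩, rfl⟩
    exact ⟨σ ∩ X, τ ∩ X, ⟨⟨σ, hσ, rfl⟩, ⟨τ, hτ, rfl⟩⟩, (Finset.union_inter_distrib_right _ _ _).symm⟩
  · rintro ⟨_, _, ⟨⟨σ, hσ, rfl⟩, ⟨τ, hτ, rfl⟩⟩, rfl⟩
    exact ⟨σ ∪ τ, ⟨σ, τ, ⟨hσ, hτ⟩, rfl⟩, Finset.union_inter_distrib_right _ _ _⟩

theorem subset_verts {K : Finset (Finset V)} {σ : Finset V} (hσ : σ ∈ K) : σ ⊆ verts K :=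
  Finset.le_sup (f := id) hσ

theorem inducedSub_congr {K : Finset (Finset V)} {X Y : Finset V}
    (h : ∀ v ∈ verts K, v ∈ X ↔ v ∈ Y) : InducedSub K X = InducedSub K Y := by
  refine Finset.image_congr fun σ hσ => ?_
  ext v
  simp only [Finset.mem_inter]
  exact and_congr_right fun hv => h v (subset_verts hσ hv)

theorem verts_inducedSub_subset (K : Finset (Finset V)) (X : Finset V) :
    verts (InducedSub K X) ⊆ verts K := by
  refine Finset.sup_le fun σ hσ => ?_
  obtain ⟨ρ, hρ, rfl⟩ := Finset.mem_image.mp hσ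
  exact Finset.inter_subset_left.trans (subset_verts hρ)

variable [LinearOrder V]

theorem IsLeray.join {K L : Finset (Finset V)} (hK : IsComplex K) (hL : IsComplex L)
    (hdisj : Disjoint (verts K) (verts L)) {a b : ℕ} (ha : IsLeray a K) (hb : IsLeray b L) :
    IsLeray (a + b) (Join K L) := by
  intro X k hk
  rw [inducedSub_join]
  exact homologyVanishes_join (A := verts K) (hK.inducedSub X) (hL.inducedSub X)
    (fun σ hσ => (subset_verts hσ).trans (verts_inducedSub_subset K X))
    (fun τ hτ => hdisj.mono_right ((subset_verts hτ).trans (verts_inducedSub_subset L X)))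
    (ha X) (hb X) hk

theorem exists_nonbounding_cycle {K : Finset (Finset V)} (hne : K.Nonempty)
    {a : ℕ} (ha : IsLeast {d : ℕ | IsLeray d K} a) :
    ∃ X, ∃ z ∈ chains (InducedSub K X) a, bdry z = 0 ∧
      ∀ u ∈ chains (InducedSub K X) (a + 1), bdry u ≠ z := by
  obtain _ | a := a
  · obtain ⟨σ, hσ⟩ := hne
    have hX : InducedSub K ∅ = {∅} := by
      ext τ
      simp only [InducedSub, Finset.inter_empty, Finset.mem_image, Finset.mem_singleton]
      exact ⟨fun ⟨_, _, h⟩ => h.symm, fun h => ⟨σ, hσ, h.symm⟩⟩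
    refine ⟨∅, Finsupp.single ∅ 1, ?_, by simp [bdry_single], fun u hu => ?_⟩
    · rw [hX]
      exact single_mem_chains 1 (Finset.mem_singleton_self _) rfl
    · have hu0 : u = 0 := by
        refine map_eq_of_chains (f := LinearMap.id) (g := 0) (fun τ hτ hn => ?_) hu
        rw [hX, Finset.mem_singleton] at hτ
        simp [hτ] at hn
      simp [hu0, eq_comm]
  · have hnot : ¬ IsLeray a K := fun h => by
      have := ha.2 h
      omega
    simp only [IsLeray, HomologyVanishes, not_forall, not_exists, not_and] at hnot
    obtain ⟨X, k, hk, z, hz, hz0, hzb⟩ := hnot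
    obtain rfl : k = a := by
      by_contra hne
      obtain ⟨u, hu, huz⟩ := ha.1 X k (by omega) z hz hz0
      exact hzb u hu huz
    exact ⟨X, z, isChainOn_iff_mem_chains.mp hz, hz0,
      fun u hu => hzb u (isChainOn_iff_mem_chains.mpr hu)⟩

end Leray

/-- For any two nonempty finite simplicial complexes `K` and `L` with disjoint vertex
sets, the Leray number of the join `K * L` equals the sum of the Leray numbers:
if `a` is the least `d` such that `K` is `d`-Leray and `b` the least such for `L`,
then `a + b` is the least `d` such that `K * L` is `d`-Leray. -/
theorem leray_number_join (K L : Finset (Finset ℕ))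
    (hK : IsComplex K) (hL : IsComplex L)
    (hKne : K.Nonempty) (hLne : L.Nonempty)
    (hdisj : Disjoint (verts K) (verts L)) (a b : ℕ)
    (ha : IsLeast {d : ℕ | IsLeray d K} a)
    (hb : IsLeast {d : ℕ | IsLeray d L} b) :
    IsLeast {d : ℕ | IsLeray d (Join K L)} (a + b) := by
  refine ⟨IsLeray.join hK hL hdisj ha.1 hb.1, fun d hd => ?_⟩
  by_contra! hlt
  obtain ⟨X, z, hz, hz0, hzb⟩ := exists_nonbounding_cycle hKne ha
  obtain ⟨Y, w, hw, hw0, hwb⟩ := exists_nonbounding_cycle hLne hb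
  let Z := (X ∩ verts K) ∪ (Y ∩ verts L)
  have hXZ : InducedSub K X = InducedSub K Z := inducedSub_congr fun v hv => by
    simp [Z, hv, Finset.disjoint_left.mp hdisj hv]
  have hYZ : InducedSub L Y = InducedSub L Z := inducedSub_congr fun v hv => by
    simp [Z, hv, Finset.disjoint_right.mp hdisj hv]
  rw [hXZ] at hz hzb
  rw [hYZ] at hw hwb
  have hKA : ∀ σ ∈ InducedSub K Z, σ ⊆ verts K := fun σ hσ =>
    (subset_verts hσ).trans (verts_inducedSub_subset K Z)
  have hLA : ∀ τ ∈ InducedSub L Z, Disjoint (verts K) τ := fun τ hτ =>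
    hdisj.mono_right ((subset_verts hτ).trans (verts_inducedSub_subset L Z))
  have hsep : ∀ σ ∈ InducedSub K Z, ∀ τ ∈ InducedSub L Z, Disjoint σ τ := fun σ hσ τ hτ =>
    (hLA τ hτ).mono_left (hKA σ hσ)
  obtain ⟨m, hm⟩ : ∃ m, a + b = m + 1 := ⟨a + b - 1, by omega⟩
  have hzw := joinMul_mem_chains hsep hz hw
  have hvan := hd Z m (by omega)
  rw [inducedSub_join] at hvan
  rw [hm] at hzw
  obtain ⟨e, he, hez⟩ := hvan _ (isChainOn_iff_mem_chains.mpr hzw)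
    (by rw [bdry_joinMul hsep hz hw, hz0, hw0]; simp)
  rw [isChainOn_iff_mem_chains] at he
  refine bdry_ne_joinMul (hK.inducedSub Z) (hL.inducedSub Z) hKA hLA hz hzb hw hwb e ?_ hez
  rwa [hm]
end

section
/- Let L be a finite abstract simplicial complex and let (C_σ : σ a nonempty face of L) be a family of convex sets in ℝ^d representing the nerve of the nonempty faces of L, i.e., for every collection M of nonempty faces of L, ⋂_{σ∈M} C_σ ≠ ∅ if and only if ⋂M ≠ ∅. For each vertex v of L choose a point p(v) ∈ ⋂{C_τ : τ a face of L with v ∈ τ}. Then for every face σ ∈ L the point set p(σ) is affinely independent. -/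
/-- Let `(C σ : σ a nonempty face of L)` be convex sets in `ℝ^d` representing the nerve
of the nonempty faces of `L` (a collection of nonempty faces has intersecting convex
sets iff it has a common vertex), and for each vertex `v` let `p v` be a point in all
the sets `C τ` with `v ∈ τ ∈ L`. Then for every face `σ ∈ L` the point set `p(σ)` is
affinely independent. -/
theorem affineIndependent_of_nerve_representation (d : ℕ) (L : Finset (Finset ℕ))
    (hL : IsComplex L) (C : Finset ℕ → Set (Fin d → ℝ))
    (hconv : ∀ σ ∈ L, σ.Nonempty → Convex ℝ (C σ))
    (hrep : ∀ M : Finset (Finset ℕ), (∀ σ ∈ M, σ ∈ L ∧ σ.Nonempty) →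
      ((∃ x, ∀ σ ∈ M, x ∈ C σ) ↔ (∃ v, ∀ σ ∈ M, v ∈ σ)))
    (p : ℕ → (Fin d → ℝ))
    (hp : ∀ v : ℕ, ∀ τ ∈ L, v ∈ τ → p v ∈ C τ) :
    ∀ σ ∈ L, AffineIndependent ℝ ((↑) : (p '' (σ : Set ℕ)) → (Fin d → ℝ)) := by
  intro σ hσ
  suffices h : AffineIndependent ℝ (fun v : (σ : Set ℕ) => p v) by
    rw [Set.image_eq_range]
    exact h.range
  by_contra h
  obtain ⟨I, x, hxI, hxJ⟩ := Convex.radon_partition h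
  -- The hull of the points over a set of vertices lies in the convex set of the face they span.
  have key : ∀ J : Set (σ : Set ℕ),
      x ∈ convexHull ℝ ((fun v : (σ : Set ℕ) => p v) '' J) →
      ∃ τ : Finset ℕ, (∀ v, v ∈ τ ↔ v ∈ Subtype.val '' J) ∧ τ ∈ L ∧ τ.Nonempty ∧ x ∈ C τ := by
    intro J hx
    have hfin : (Subtype.val '' J : Set ℕ).Finite :=
      σ.finite_toSet.subset (Subtype.coe_image_subset _ _)
    have hmem : ∀ v, v ∈ hfin.toFinset ↔ v ∈ Subtype.val '' J := fun v => hfin.mem_toFinset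
    have hτL : hfin.toFinset ∈ L := by
      refine hL σ hσ _ fun v hv => ?_
      obtain ⟨w, -, rfl⟩ := (hmem v).1 hv
      exact w.2
    have hne : hfin.toFinset.Nonempty := by
      obtain ⟨_, v, hv, -⟩ := convexHull_nonempty_iff.1 ⟨x, hx⟩
      exact ⟨v, (hmem v).2 ⟨v, hv, rfl⟩⟩
    refine ⟨hfin.toFinset, hmem, hτL, hne, convexHull_min ?_ (hconv _ hτL hne) hx⟩
    rintro _ ⟨v, hv, rfl⟩
    exact hp v _ hτL ((hmem v).2 ⟨v, hv, rfl⟩)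
  obtain ⟨α, hα, hαL, hαne, hxα⟩ := key I hxI
  obtain ⟨β, hβ, hβL, hβne, hxβ⟩ := key Iᶜ hxJ
  obtain ⟨v, hv⟩ := (hrep {α, β} (by simp [hαL, hαne, hβL, hβne])).1 ⟨x, by simp [hxα, hxβ]⟩
  obtain ⟨a, ha, rfl⟩ := (hα v).1 (hv α (by simp))
  obtain ⟨b, hb, hab⟩ := (hβ a).1 (hv β (by simp))
  exact hb (Subtype.ext hab ▸ ha)
end

section
/- Let L be a finite abstract simplicial complex and let (C_σ : σ a nonempty face of L) be a family of convex sets in ℝ^d representing the nerve of the nonempty faces of L, i.e., for every collection M of nonempty faces of L, ⋂_{σ∈M} C_σ ≠ ∅ if and only if ⋂M ≠ ∅. For each vertex v of L choose a point p(v) ∈ ⋂{C_τ : τ a face of L with v ∈ τ}, and set D_σ := conv(p(σ)) for each face σ ∈ L. Then for every two faces σ, τ ∈ L one has D_σ ∩ D_τ = D_{σ∩τ}. -/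
section ConvexHullInter

variable {ι E : Type*} [AddCommGroup E] [Module ℝ E]

/-- A point lies in the convex hull of the image of a finite set iff it is a convex combination,
with weights indexed by the whole index type and vanishing off that set. -/
lemma mem_convexHull_image_finset_iff {s : Finset ι} {p : ι → E} {x : E} :
    x ∈ convexHull ℝ (p '' (s : Set ι)) ↔
      ∃ w : ι → ℝ, (∀ i, 0 ≤ w i) ∧ (∀ i ∉ s, w i = 0) ∧
        ∑ i ∈ s, w i = 1 ∧ ∑ i ∈ s, w i • p i = x := by
  classical
  constructor
  · refine fun hx => convexHull_min (t := {x | ∃ w : ι → ℝ, (∀ i, 0 ≤ w i) ∧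
      (∀ i ∉ s, w i = 0) ∧ ∑ i ∈ s, w i = 1 ∧ ∑ i ∈ s, w i • p i = x}) ?_ ?_ hx
    · rintro _ ⟨i, hi, rfl⟩
      have hi' : i ∈ s := hi
      refine ⟨Pi.single i 1, fun j => ?_, fun j hj => ?_, ?_, ?_⟩
      · by_cases h : j = i <;> simp [h]
      · exact Pi.single_eq_of_ne (ne_of_mem_of_not_mem hi' hj).symm _
      · simp [Pi.single_apply, hi']
      · simp [Pi.single_apply, ite_smul, hi']
    · rintro _ ⟨v, hv, hv0, hv1, rfl⟩ _ ⟨w, hw, hw0, hw1, rfl⟩ a b ha hb hab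
      refine ⟨fun i => a * v i + b * w i, fun i => ?_, fun i hi => ?_, ?_, ?_⟩
      · have := hv i
        have := hw i
        positivity
      · simp [hv0 i hi, hw0 i hi]
      · simp [Finset.sum_add_distrib, ← Finset.mul_sum, hv1, hw1, hab]
      · simp [add_smul, mul_smul, Finset.sum_add_distrib, Finset.smul_sum]
  · rintro ⟨w, hw, -, hw1, rfl⟩
    exact (convex_convexHull ℝ _).sum_mem (fun i _ => hw i) hw1
      fun i hi => subset_convexHull ℝ _ ⟨i, hi, rfl⟩

lemma sum_smul_eq_sum_pos_sub_sum_neg (u : Finset ι) (c : ι → ℝ) (z : ι → E) :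
    ∑ i ∈ u, c i • z i =
      ∑ i ∈ u with 0 < c i, c i • z i - ∑ i ∈ u with c i < 0, (-c i) • z i := by
  rw [Finset.sum_filter, Finset.sum_filter, ← Finset.sum_sub_distrib]
  refine Finset.sum_congr rfl fun i _ => ?_
  rcases lt_trichotomy (c i) 0 with h | h | h
  · simp [h, h.not_gt]
  · simp [h]
  · simp [h, h.not_gt]

lemma sum_smul_sub_sum_smul_eq_sum_union [DecidableEq ι] {s t : Finset ι} {a b : ι → ℝ}
    (ha : ∀ i ∉ s, a i = 0) (hb : ∀ i ∉ t, b i = 0) (z : ι → E) :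
    ∑ i ∈ s, a i • z i - ∑ i ∈ t, b i • z i = ∑ i ∈ s ∪ t, (a i - b i) • z i := by
  simp only [sub_smul, Finset.sum_sub_distrib]
  congr 1
  · exact Finset.sum_subset Finset.subset_union_left fun i _ hi => by simp [ha i hi]
  · exact Finset.sum_subset Finset.subset_union_right fun i _ hi => by simp [hb i hi]

/-- If disjoint subsets of `s` and `t` always span disjoint convex hulls, then the convex hulls
spanned by `s` and `t` meet exactly in the one spanned by `s ∩ t`. -/
lemma convexHull_image_inter_of_disjoint [DecidableEq ι] {s t : Finset ι} {p : ι → E}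
    (h : ∀ A ⊆ s, ∀ B ⊆ t, Disjoint A B →
      Disjoint (convexHull ℝ (p '' (A : Set ι))) (convexHull ℝ (p '' (B : Set ι)))) :
    convexHull ℝ (p '' (s : Set ι)) ∩ convexHull ℝ (p '' (t : Set ι)) =
      convexHull ℝ (p '' ((s ∩ t : Finset ι) : Set ι)) := by
  refine Set.Subset.antisymm ?_ (Set.subset_inter
    (convexHull_mono <| Set.image_mono <| Finset.coe_subset.2 Finset.inter_subset_left)
    (convexHull_mono <| Set.image_mono <| Finset.coe_subset.2 Finset.inter_subset_right))
  rintro x ⟨hxs, hxt⟩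
  obtain ⟨a, ha, ha0, ha1, hax⟩ := mem_convexHull_image_finset_iff.1 hxs
  obtain ⟨b, hb, hb0, hb1, hbx⟩ := mem_convexHull_image_finset_iff.1 hxt
  set c : ι → ℝ := fun i => a i - b i with hc
  set P : Finset ι := {i ∈ s ∪ t | 0 < c i}
  set N : Finset ι := {i ∈ s ∪ t | c i < 0}
  have hpoint : ∑ i ∈ P, c i • p i = ∑ i ∈ N, (-c i) • p i := by
    rw [← sub_eq_zero, ← sum_smul_eq_sum_pos_sub_sum_neg,
      ← sum_smul_sub_sum_smul_eq_sum_union ha0 hb0, hax, hbx, sub_self]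
  have hmass : ∑ i ∈ P, c i = ∑ i ∈ N, -c i := by
    have := sum_smul_eq_sum_pos_sub_sum_neg (s ∪ t) c (fun _ => (1 : ℝ))
    rw [← sum_smul_sub_sum_smul_eq_sum_union ha0 hb0] at this
    simp only [smul_eq_mul, mul_one, ha1, hb1, sub_self] at this
    exact sub_eq_zero.1 this.symm
  have hPpos : ∀ i ∈ P, 0 < c i := fun i hi => (Finset.mem_filter.1 hi).2
  have hPs : P ⊆ s := fun i hi => by
    by_contra his
    have := hPpos i hi
    have := hb i
    simp only [hc, ha0 i his] at *
    linarith
  have hNneg : ∀ i ∈ N, 0 < -c i := fun i hi => neg_pos.2 (Finset.mem_filter.1 hi).2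
  have hNt : N ⊆ t := fun i hi => by
    by_contra hit
    have := hNneg i hi
    have := ha i
    simp only [hc, hb0 i hit] at *
    linarith
  have hPN : Disjoint P N := Finset.disjoint_left.2 fun i hi hi' => by
    linarith [hPpos i hi, hNneg i hi']
  have hPempty : P = ∅ := by
    by_contra hne
    have hpos : 0 < ∑ i ∈ P, c i := Finset.sum_pos hPpos (Finset.nonempty_iff_ne_empty.2 hne)
    have hmemP : P.centerMass c p ∈ convexHull ℝ (p '' (P : Set ι)) :=
      P.centerMass_mem_convexHull (fun i hi => (hPpos i hi).le) hpos fun i hi => ⟨i, hi, rfl⟩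
    have hmemN : N.centerMass (fun i => -c i) p ∈ convexHull ℝ (p '' (N : Set ι)) :=
      N.centerMass_mem_convexHull (fun i hi => (hNneg i hi).le) (hmass ▸ hpos)
        fun i hi => ⟨i, hi, rfl⟩
    refine Set.disjoint_left.1 (h P hPs N hNt hPN) hmemP ?_
    rwa [Finset.centerMass, hmass, hpoint]
  have hle : ∀ i ∈ s ∪ t, a i ≤ b i := fun i hi => by
    by_contra hlt
    have : i ∈ P := Finset.mem_filter.2 ⟨hi, sub_pos.2 (not_le.1 hlt)⟩
    simp [hPempty] at this
  have ha_inter : ∀ i ∉ s ∩ t, a i = 0 := fun i hi => by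
    by_cases his : i ∈ s
    · have hit : i ∉ t := fun hit => hi (Finset.mem_inter.2 ⟨his, hit⟩)
      exact le_antisymm (hb0 i hit ▸ hle i (Finset.mem_union_left t his)) (ha i)
    · exact ha0 i his
  refine mem_convexHull_image_finset_iff.2 ⟨a, ha, ha_inter, ?_, ?_⟩
  · rw [← ha1]
    exact Finset.sum_subset Finset.inter_subset_left fun i _ hi => ha_inter i hi
  · rw [← hax]
    exact Finset.sum_subset Finset.inter_subset_left fun i _ hi => by simp [ha_inter i hi]

end ConvexHullInter

/-- Let `(C σ : σ a nonempty face of L)` be convex sets in `ℝ^d` representing the nerve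
of the nonempty faces of `L` (a collection of nonempty faces has intersecting convex
sets iff it has a common vertex), for each vertex `v` let `p v` be a point in all the
sets `C τ` with `v ∈ τ ∈ L`, and let `D σ := conv(p(σ))`. Then for every two faces
`σ, τ ∈ L` one has `D σ ∩ D τ = D (σ ∩ τ)`. -/
theorem convexHull_inter_of_nerve_representation (d : ℕ) (L : Finset (Finset ℕ))
    (hL : IsComplex L) (C : Finset ℕ → Set (Fin d → ℝ))
    (hconv : ∀ σ ∈ L, σ.Nonempty → Convex ℝ (C σ))
    (hrep : ∀ M : Finset (Finset ℕ), (∀ σ ∈ M, σ ∈ L ∧ σ.Nonempty) →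
      ((∃ x, ∀ σ ∈ M, x ∈ C σ) ↔ (∃ v, ∀ σ ∈ M, v ∈ σ)))
    (p : ℕ → (Fin d → ℝ))
    (hp : ∀ v : ℕ, ∀ τ ∈ L, v ∈ τ → p v ∈ C τ) :
    ∀ σ ∈ L, ∀ τ ∈ L,
      convexHull ℝ (p '' (σ : Set ℕ)) ∩ convexHull ℝ (p '' (τ : Set ℕ)) =
        convexHull ℝ (p '' ((σ ∩ τ : Finset ℕ) : Set ℕ)) := by
  intro σ hσ τ hτ
  have hull_subset : ∀ A ∈ L, A.Nonempty → convexHull ℝ (p '' (A : Set ℕ)) ⊆ C A :=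
    fun A hA hne => convexHull_min (Set.image_subset_iff.2 fun v hv => hp v A hA hv)
      (hconv A hA hne)
  refine convexHull_image_inter_of_disjoint fun A hAσ B hBτ hAB => ?_
  have hA := hL σ hσ A hAσ
  have hB := hL τ hτ B hBτ
  rcases A.eq_empty_or_nonempty with rfl | hAne
  · simp
  rcases B.eq_empty_or_nonempty with rfl | hBne
  · simp
  refine Set.disjoint_left.2 fun x hxA hxB => ?_
  obtain ⟨v, hv⟩ := (hrep {A, B} (by simp [hA, hB, hAne, hBne])).1
    ⟨x, by simp [hull_subset A hA hAne hxA, hull_subset B hB hBne hxB]⟩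
  exact Finset.disjoint_left.1 hAB (hv A (by simp)) (hv B (by simp))
end
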